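/- arXiv:0802.1226 — 5 statements merged into one kernel-verified Lean document; each statement's English description precedes it below -/
import Mathlib

section
/- For every n > 1, every NBW accepting the complement Σ_n^ω \ L(FB_n) has at least L(n) states. -/
namespace YanPaper

/-- A finite run, represented as the list of visited states, over a finite word. -/
def RunOn {S A : Type*} (Δ : S → A → S → Prop) : List S → List A → Prop
  | [_], [] => True
  | p :: q :: ρ, a :: w => Δ p a q ∧ RunOn Δ (q :: ρ) w
  | _, _ => False

/-- `p` reaches `q` via some finite run over the word `w`. -/
def Reaches {S A : Type*} (Δ : S → A → S → Prop) (p : S) (w : List A) (q : S) : Prop :=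
  ∃ ρ : List S, RunOn Δ ρ w ∧ ρ.head? = some p ∧ ρ.getLast? = some q

/-- `p` reaches `q` via some finite run over `w` that visits the set `T`. -/
def ReachesVisit {S A : Type*} (Δ : S → A → S → Prop) (T : Set S) (p : S) (w : List A)
    (q : S) : Prop :=
  ∃ ρ : List S, RunOn Δ ρ w ∧ ρ.head? = some p ∧ ρ.getLast? = some q ∧ ∃ s ∈ ρ, s ∈ T

/-- Nondeterministic finite word automaton. -/
structure NFW (A : Type*) (S : Type*) where
  I : Set S
  Δ : S → A → S → Prop
  F : Set S

def NFW.Lang {A S : Type*} (M : NFW A S) : Set (List A) :=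
  {w | ∃ p ∈ M.I, ∃ q ∈ M.F, Reaches M.Δ p w q}

/-- The full NFW over state set `S`: the alphabet is the set of all binary relations on `S`. -/
def FullNFW (S : Type*) (I F : Set S) : NFW (Set (S × S)) S where
  I := I
  Δ := fun p a q => (p, q) ∈ a
  F := F

/-- Minimal number of states of an NFW over alphabet `A` accepting the language `L`. -/
noncomputable def NFWminStates (A : Type*) (L : Set (List A)) : ℕ :=
  sInf {c : ℕ | ∃ C : NFW A (Fin c), C.Lang = L}

/-- A two letter alphabet. -/
inductive AB : Type
  | a : AB
  | b : AB

/-- States occurring infinitely often in an infinite run. -/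
def InfOcc {S : Type*} (ρ : ℕ → S) : Set S := {s | ∀ n : ℕ, ∃ m, n ≤ m ∧ ρ m = s}

/-- Nondeterministic Büchi word automaton. -/
structure NBW (A : Type*) (S : Type*) where
  I : Set S
  Δ : S → A → S → Prop
  F : Set S

def NBW.Lang {A S : Type*} (M : NBW A S) : Set (ℕ → A) :=
  {α | ∃ ρ : ℕ → S, ρ 0 ∈ M.I ∧ (∀ i, M.Δ (ρ i) (α i) (ρ (i + 1))) ∧
        (InfOcc ρ ∩ M.F).Nonempty}

/-- The full NBW over state set `S`. -/
def FullNBW (S : Type*) (I F : Set S) : NBW (Set (S × S)) S where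
  I := I
  Δ := fun p a q => (p, q) ∈ a
  F := F

/-- Minimal number of states of an NBW over alphabet `A` accepting the ω-language `L`. -/
noncomputable def NBWminStates (A : Type*) (L : Set (ℕ → A)) : ℕ :=
  sInf {c : ℕ | ∃ C : NBW A (Fin c), C.Lang = L}

/-- Vertex `(q, l)` of the Δ-graph of `α` is reachable from an initial vertex `(q_I, 0)`. -/
def GraphReach {A S : Type*} (M : NBW A S) (α : ℕ → A) (q : S) (l : ℕ) : Prop :=
  ∃ ρ : ℕ → S, ρ 0 ∈ M.I ∧ (∀ i, i < l → M.Δ (ρ i) (α i) (ρ (i + 1))) ∧ ρ l = q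

/-- A co-Büchi ranking for the Δ-graph of `α` under `M`, as a partial function
`S × ℕ → {0, …, 2n-2}` represented with `Option ℕ`. -/
def CRanking {A S : Type*} [Fintype S] (M : NBW A S) (α : ℕ → A)
    (f : S → ℕ → Option ℕ) : Prop :=
  (∀ q l r, f q l = some r → r ≤ 2 * Fintype.card S - 2) ∧
  (∀ q l, (f q l).isSome ↔ GraphReach M α q l) ∧
  (∀ q l r, f q l = some r → Odd r → q ∉ M.F) ∧
  (∀ q l q', M.Δ q (α l) q' → ∀ r r', f q l = some r → f q' (l + 1) = some r' → r' ≤ r)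

/-- The C-ranking `f` is odd: every infinite path of the Δ-graph starting at an initial
vertex has infinitely many odd-ranked vertices. -/
def OddCRanking {A S : Type*} [Fintype S] (M : NBW A S) (α : ℕ → A)
    (f : S → ℕ → Option ℕ) : Prop :=
  ∀ ρ : ℕ → S, ρ 0 ∈ M.I → (∀ i, M.Δ (ρ i) (α i) (ρ (i + 1))) →
    ∀ N : ℕ, ∃ l, N ≤ l ∧ ∃ r, f (ρ l) l = some r ∧ Odd r

/-- The state space of the full NBW `FB n`: `none` is the final state `s_f`, and
`some i` is the main state `s_i`. -/
abbrev FBState (n : ℕ) := Option (Fin (n - 1))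

/-- The alphabet of a full automaton with state space `FBState n`. -/
abbrev FBAlpha (n : ℕ) := Set (FBState n × FBState n)

/-- The full NBW `FB n`, with `n` states, main states initial and `s_f = none` final. -/
def FB (n : ℕ) : NBW (FBAlpha n) (FBState n) where
  I := {s | s ≠ none}
  Δ := fun p a q => (p, q) ∈ a
  F := {none}

/-- A `Q(m)`-ranking for `FB n`: a function on the main states with values in
`{0, …, 2m-1}` whose range contains all odd numbers in `{0, …, 2m-1}`. -/
def QRanking (n m : ℕ) (g : Fin (n - 1) → ℕ) : Prop :=
  (∀ q, g q < 2 * m) ∧ ∀ r, r < 2 * m → Odd r → ∃ q, g q = r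

/-- `w` is an `(f, g)`-segment for `FB n` (properties (P1), (P2), (P3)). -/
def IsSeg (n : ℕ) (f g : Fin (n - 1) → ℕ) (w : List (FBAlpha n)) : Prop :=
  w ≠ [] ∧
  (∀ p q : Fin (n - 1),
    Reaches (FB n).Δ (some p) w (some q) ↔ (g q < f p ∨ (f p = g q ∧ Odd (f p)))) ∧
  (∀ p q : Fin (n - 1),
    ReachesVisit (FB n).Δ {none} (some p) w (some q) ↔ g q < f p) ∧
  (∀ p q : FBState n, Reaches (FB n).Δ p w q → p ≠ none ∧ q ≠ none)

/-- `L(n, m)`: the number of `Q(m)`-rankings for `FB n`. -/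
noncomputable def Lnm (n m : ℕ) : ℕ := Nat.card {g : Fin (n - 1) → ℕ // QRanking n m g}

/-- `L(n) = max_{1 ≤ m < n} L(n, m)`. -/
noncomputable def Lmax (n : ℕ) : ℕ := (Finset.Ico 1 n).sup (fun m => Lnm n m)

/-- Nondeterministic Muller word automaton. -/
structure NMW (A : Type*) (S : Type*) where
  I : Set S
  Δ : S → A → S → Prop
  Acc : Set (Set S)

def NMW.Lang {A S : Type*} (M : NMW A S) : Set (ℕ → A) :=
  {α | ∃ ρ : ℕ → S, ρ 0 ∈ M.I ∧ (∀ i, M.Δ (ρ i) (α i) (ρ (i + 1))) ∧ InfOcc ρ ∈ M.Acc}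

/-- Nondeterministic generalized Büchi word automaton of index `k`. -/
structure NGBW (A : Type*) (S : Type*) where
  I : Set S
  Δ : S → A → S → Prop
  k : ℕ
  F : Fin k → Set S

def NGBW.Lang {A S : Type*} (M : NGBW A S) : Set (ℕ → A) :=
  {α | ∃ ρ : ℕ → S, ρ 0 ∈ M.I ∧ (∀ i, M.Δ (ρ i) (α i) (ρ (i + 1))) ∧
        ∀ i, (InfOcc ρ ∩ M.F i).Nonempty}

/-- Nondeterministic Streett word automaton of index `k`. -/
structure NSW (A : Type*) (S : Type*) where
  I : Set S
  Δ : S → A → S → Prop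
  k : ℕ
  acc : Fin k → Set S × Set S

def NSW.Lang {A S : Type*} (M : NSW A S) : Set (ℕ → A) :=
  {α | ∃ ρ : ℕ → S, ρ 0 ∈ M.I ∧ (∀ i, M.Δ (ρ i) (α i) (ρ (i + 1))) ∧
        ∀ i, (InfOcc ρ ∩ (M.acc i).2).Nonempty → (InfOcc ρ ∩ (M.acc i).1).Nonempty}

/-- Nondeterministic Rabin word automaton of index `k`. -/
structure NRW (A : Type*) (S : Type*) where
  I : Set S
  Δ : S → A → S → Prop
  k : ℕ
  acc : Fin k → Set S × Set S

def NRW.Lang {A S : Type*} (M : NRW A S) : Set (ℕ → A) :=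
  {α | ∃ ρ : ℕ → S, ρ 0 ∈ M.I ∧ (∀ i, M.Δ (ρ i) (α i) (ρ (i + 1))) ∧
        ∃ i, (InfOcc ρ ∩ (M.acc i).1).Nonempty ∧ InfOcc ρ ∩ (M.acc i).2 = ∅}

/-- The `k`-fold concatenation `w^k` of a finite word. -/
def listPow {A : Type*} (w : List A) (k : ℕ) : List A := (List.replicate k w).flatten

/-- `α` is the ω-word `u · v^ω`. -/
def IsUVOmega {A : Type*} (u v : List A) (α : ℕ → A) : Prop :=
  (∀ i (h : i < u.length), α i = u.get ⟨i, h⟩) ∧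
  (∀ i j (h : j < v.length), α (u.length + i * v.length + j) = v.get ⟨j, h⟩)

/-- A GC-segment of the NGBW `B`: a nonempty finite word `w` with `w^ω ∉ L(B)`. -/
def GCSeg {A S : Type*} (B : NGBW A S) (w : List A) : Prop :=
  w ≠ [] ∧ ∀ α, IsUVOmega [] w α → α ∉ B.Lang

/-- Two GC-segments conflict: every ω-word `w₁^{k₀} (w₁^{k₁} w₂^{k₂})^ω` is in `L(B)`. -/
def Conflict {A S : Type*} (B : NGBW A S) (w₁ w₂ : List A) : Prop :=
  ∀ k₀ k₁ k₂ : ℕ, 0 < k₀ → 0 < k₁ → 0 < k₂ →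
    ∀ α, IsUVOmega (listPow w₁ k₀) (listPow w₁ k₁ ++ listPow w₂ k₂) α → α ∈ B.Lang

/-- The full NGBW `FB (n,k)` with all states initial, distinguished state `s_nf = none`,
and acceptance sets `F i` (subsets of the main states). -/
def FBgen (n k : ℕ) (F : Fin k → Finset (Fin (n - 1))) :
    NGBW (FBAlpha n) (FBState n) where
  I := Set.univ
  Δ := fun p a q => (p, q) ∈ a
  k := k
  F := fun i => {s | ∃ q ∈ F i, s = some q}

/-- The conditions on the acceptance condition of `FB (n,k)`: the sets are pairwise
distinct, each of size `⌊(n-1)/2⌋`, and each main state avoids at least `⌊k/2⌋` sets. -/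
def GoodAcc (n k : ℕ) (F : Fin k → Finset (Fin (n - 1))) : Prop :=
  Function.Injective F ∧ (∀ i, (F i).card = (n - 1) / 2) ∧
  ∀ q : Fin (n - 1), k / 2 ≤ {i : Fin k | q ∉ F i}.ncard

/-- A PGCL-ranking for `FB (n,k)`: `f` is a bijection from the main states onto
`{1, …, n-1}` and `g` chooses for each main state `q` an index with `q ∉ F (g q)`. -/
def PGCL (n k : ℕ) (F : Fin k → Finset (Fin (n - 1)))
    (f : Fin (n - 1) → ℕ) (g : Fin (n - 1) → Fin k) : Prop :=
  (∀ p, 1 ≤ f p ∧ f p ≤ n - 1) ∧ Function.Injective f ∧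
  (∀ r, 1 ≤ r → r ≤ n - 1 → ∃ p, f p = r) ∧
  ∀ q, q ∉ F (g q)

/-- `ρ` is a finite run over `w` from `p` to `q`. -/
def RunFromTo {S A : Type*} (Δ : S → A → S → Prop) (w : List A) (p q : S)
    (ρ : List S) : Prop :=
  RunOn Δ ρ w ∧ ρ.head? = some p ∧ ρ.getLast? = some q

/-- `w` is an `⟨f, g⟩`-segment for `FB (n,k)` (properties (Q0)–(Q3)). -/
def IsSegGen (n k : ℕ) (F : Fin k → Finset (Fin (n - 1)))
    (f : Fin (n - 1) → ℕ) (g : Fin (n - 1) → Fin k)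
    (w : List (FBAlpha n)) : Prop :=
  w ≠ [] ∧
  -- (Q0) every finite run over `w` ends in a main state
  (∀ (ρ : List (FBState n)) (x : FBState n),
    RunOn (FBgen n k F).Δ ρ w → ρ.getLast? = some x → x ≠ none) ∧
  -- (Q1)
  (∀ p : Fin (n - 1),
    (∃! ρ, RunFromTo (FBgen n k F).Δ w (some p) (some p) ρ) ∧
    ∀ ρ, RunFromTo (FBgen n k F).Δ w (some p) (some p) ρ →
      (∀ i, i ≠ g p → ∃ s ∈ ρ, ∃ q ∈ F i, s = some q) ∧
      (∀ s ∈ ρ, ∀ q ∈ F (g p), s ≠ some q)) ∧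
  -- (Q2)
  (∀ p q : Fin (n - 1), f q < f p →
    (∃! ρ, RunFromTo (FBgen n k F).Δ w (some p) (some q) ρ) ∧
    ∀ ρ, RunFromTo (FBgen n k F).Δ w (some p) (some q) ρ →
      ∀ i, ∃ s ∈ ρ, ∃ r ∈ F i, s = some r) ∧
  -- (Q3)
  (∀ p q : Fin (n - 1), f p < f q →
    ¬∃ ρ, RunFromTo (FBgen n k F).Δ w (some p) (some q) ρ)

/-- lasso index -/
def lassoIdx (a b i : ℕ) : ℕ := if i < a then i else a + (i - a) % (b - a)

theorem lassoIdx_lt {a b : ℕ} (hab : a < b) (i : ℕ) : lassoIdx a b i < b := by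
  unfold lassoIdx
  split_ifs with h
  · omega
  · have := Nat.mod_lt (i - a) (show b - a > 0 by omega)
    omega

theorem lassoIdx_succ {a b : ℕ} (hab : a < b) (i : ℕ) :
    lassoIdx a b (i + 1) = lassoIdx a b i + 1 ∨
      (lassoIdx a b (i + 1) = a ∧ lassoIdx a b i + 1 = b) := by
  unfold lassoIdx
  have hd : b - a > 0 := by omega
  by_cases h1 : i + 1 < a
  · left
    rw [if_pos h1, if_pos (by omega)]
  · by_cases h2 : i < a
    · left
      have : i + 1 = a := by omega
      rw [if_neg h1, if_pos h2, this]
      simp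
    · rw [if_neg h1, if_neg h2]
      have e : i + 1 - a = (i - a) + 1 := by omega
      rw [e]
      have hlt := Nat.mod_lt (i - a) hd
      by_cases h3 : (i - a) % (b - a) + 1 < b - a
      · left
        rw [Nat.add_mod_eq_ite, Nat.mod_eq_of_lt (a := 1) (by omega), if_neg (by omega)]
        omega
      · right
        have h4 : (i - a) % (b - a) + 1 = b - a := by omega
        refine ⟨?_, by omega⟩
        rw [← Nat.mod_add_mod, h4]
        simp

theorem lasso_mem {A S : Type*} (M : NBW A S) (α : ℕ → A) (σ : ℕ → S) (a b c : ℕ)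
    (hab : a < b) (h0 : σ 0 ∈ M.I) (hs : ∀ i, i < b → M.Δ (σ i) (α i) (σ (i + 1)))
    (hl : σ a = σ b) (hac : a ≤ c) (hcb : c < b) (hc : σ c ∈ M.F) :
    (fun i => α (lassoIdx a b i)) ∈ M.Lang := by
  refine ⟨fun i => σ (lassoIdx a b i), ?_, ?_, ⟨σ c, ?_, hc⟩⟩
  · have : lassoIdx a b 0 = 0 := by
      unfold lassoIdx
      split_ifs with h
      · rfl
      · simp; omega
    simpa [this] using h0
  · intro i
    have h1 := hs _ (lassoIdx_lt hab i)
    rcases lassoIdx_succ hab i with h | ⟨h, h'⟩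
    · simp only [h]; exact h1
    · simp only [h]; rw [h', ← hl] at h1; exact h1
  · intro N
    refine ⟨a + ((c - a) + (b - a) * N), ?_, ?_⟩
    · have : 1 * N ≤ (b - a) * N := Nat.mul_le_mul_right _ (by omega)
      omega
    · have : lassoIdx a b (a + ((c - a) + (b - a) * N)) = c := by
        unfold lassoIdx
        rw [if_neg (by omega), Nat.add_sub_cancel_left, Nat.add_mul_mod_self_left,
          Nat.mod_eq_of_lt (by omega)]
        omega
      simp only [this]

/-- extended rank at time `k` -/
def rk {n : ℕ} (P : ℕ) (H : ℕ → Fin (n - 1) → ℕ) (k : ℕ) : FBState n → ℕ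
  | none => k % P
  | some p => H (k / (2 * P)) p

/-- the hard word -/
def hardWord {n : ℕ} (P : ℕ) (H : ℕ → Fin (n - 1) → ℕ) (k : ℕ) : FBAlpha n :=
  {x | rk P H (k + 1) x.2 ≤ rk P H k x.1 ∧ (x.1 = none → rk P H (k + 1) x.2 < rk P H k x.1)}

theorem hardWord_not_mem {n : ℕ} (P : ℕ) (H : ℕ → Fin (n - 1) → ℕ) :
    hardWord P H ∉ (FB n).Lang := by
  rintro ⟨ρ, -, hρ, s, hs, hF⟩
  have hsn : s = none := hF
  subst hsn
  have hanti : Antitone (fun k => rk P H k (ρ k)) :=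
    antitone_nat_of_succ_le (fun k => (hρ k).1)
  let k0 := Function.argmin (fun k => rk P H k (ρ k))
  obtain ⟨k, hk, hk'⟩ := hs k0
  have h1 := (hρ k).2 hk'
  have h2 := hanti hk
  have h3 : rk P H k0 (ρ k0) ≤ rk P H (k + 1) (ρ (k + 1)) :=
    Function.argmin_le (fun k => rk P H k (ρ k)) (k + 1)
  simp only at h1 h2
  omega

theorem loop_exists {n m : ℕ} (H : ℕ → Fin (n - 1) → ℕ) (hH : ∀ i, QRanking n m (H i))
    (s t : ℕ) (hst : s < t) (p : Fin (n - 1)) (hp : H t p < H s p) :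
    ∃ (σ : ℕ → FBState n) (c : ℕ), σ 0 ≠ none ∧
      (∀ i, i < 2 * (2 * m) * t + 2 * m →
        (σ i, σ (i + 1)) ∈ hardWord (2 * m) H i) ∧
      σ (2 * (2 * m) * s + 2 * m) = σ (2 * (2 * m) * t + 2 * m) ∧
      2 * (2 * m) * s + 2 * m ≤ c ∧ c < 2 * (2 * m) * t + 2 * m ∧ σ c = none := by
  have hm : 0 < m := by have := (hH s).1 p; omega
  have hrk : ∀ r, ∃ o : ℕ → Fin (n - 1), r < 2 * m → Odd r →
      ∀ k, rk (2 * m) H k (some (o k)) = r := by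
    intro r
    by_cases h : r < 2 * m ∧ Odd r
    · choose o ho using fun i => (hH i).2 r h.1 h.2
      exact ⟨fun k => o (k / (2 * (2 * m))), fun _ _ k => ho _⟩
    · exact ⟨fun _ => p, fun h1 h2 => absurd ⟨h1, h2⟩ h⟩
  have hlt : ∀ k q, rk (2 * m) H k (some q) < 2 * m := fun k q => (hH _).1 q
  obtain ⟨top, htop⟩ := hrk (2 * m - 1)
  replace htop := htop (by omega) (by rw [Nat.odd_iff]; omega)
  -- block facts
  have hmain : ∀ u k, 2 * (2 * m) * u ≤ k → k < 2 * (2 * m) * u + 2 * (2 * m) →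
      rk (2 * m) H k (some p) = H u p := by
    intro u k h1 h2
    have : k / (2 * (2 * m)) = u := by
      apply Nat.div_eq_of_lt_le
      · rw [mul_comm]; exact h1
      · rw [add_mul, mul_comm u]; omega
    simp only [rk, this]
  have hnone : ∀ u j, j < 2 * m → rk (2 * m) (n := n) H (2 * (2 * m) * u + j) none = j := by
    intro u j hj
    simp only [rk]
    rw [show 2 * (2 * m) * u + j = j + 2 * m * (2 * u) by ring, Nat.add_mul_mod_self_left,
      Nat.mod_eq_of_lt hj]
  have hnone2 : ∀ u j, j < 2 * m →
      rk (2 * m) (n := n) H (2 * (2 * m) * u + 2 * m + j) none = j := by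
    intro u j hj
    simp only [rk]
    rw [show 2 * (2 * m) * u + 2 * m + j = j + 2 * m * (2 * u + 1) by ring,
      Nat.add_mul_mod_self_left, Nat.mod_eq_of_lt hj]
  have hgap : 2 * (2 * m) * s + 2 * (2 * m) ≤ 2 * (2 * m) * t := by
    have : 2 * (2 * m) * (s + 1) ≤ 2 * (2 * m) * t := Nat.mul_le_mul_left _ hst
    rw [mul_add] at this; omega
  have hx : H s p < 2 * m := (hH s).1 p
  obtain ⟨A, hA⟩ : ∃ A, A = 2 * (2 * m) * s := ⟨_, rfl⟩
  obtain ⟨B, hB⟩ : ∃ B, B = 2 * (2 * m) * t := ⟨_, rfl⟩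
  have hmS := hmain s
  have hmT := hmain t
  have hnS := hnone2 s (H s p) hx
  have hnT := hnone t (H s p) hx
  rw [← hA] at hmS hnS hgap ⊢
  rw [← hB] at hmT hnT hgap ⊢
  rcases Nat.even_or_odd (H s p) with he | ho
  · have he2 : H s p % 2 = 0 := Nat.even_iff.1 he
    obtain ⟨o, ho⟩ := hrk (H s p - 1)
    replace ho := ho (by omega) (by rw [Nat.odd_iff]; omega)
    refine ⟨fun k => if k < A + 2 * m then some (top k) else
      if k < A + 2 * m + H s p then some p else
      if k = A + 2 * m + H s p then none else
      if k < B + 2 * m then some (o k) else some p, A + 2 * m + H s p, ?_, ?_, ?_, ?_, ?_, ?_⟩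
    · simp only; rw [if_pos (by omega)]; simp
    · intro i hi
      have e1 := htop i
      have e2 := htop (i + 1)
      have e3 := ho i
      have e4 := ho (i + 1)
      have e5 := hmS i
      have e6 := hmS (i + 1)
      have e7 := hmT (i + 1)
      have e8 := hlt (i + 1) p
      have e9 : i = A + 2 * m + H s p → rk (2 * m) (n := n) H i none = H s p := by
        rintro rfl; exact hnS
      have e10 : i + 1 = A + 2 * m + H s p → rk (2 * m) (n := n) H (i + 1) none = H s p := by
        intro h; rw [h]; exact hnS
      simp only [hardWord, Set.mem_ofPred_eq]
      split_ifs <;> simp <;> omega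
    · simp only
      rw [if_neg (by omega), if_pos (by omega), if_neg (by omega), if_neg (by omega),
        if_neg (by omega), if_neg (by omega)]
    · omega
    · omega
    · simp
  · have ho2 : H s p % 2 = 1 := Nat.odd_iff.1 ho
    obtain ⟨o, ho⟩ := hrk (H s p)
    replace ho := ho (by omega) (by rw [Nat.odd_iff]; omega)
    refine ⟨fun k => if k < A + 2 * m then some (top k) else
      if k = A + 2 * m then some p else
      if k < B + H s p then some (o k) else
      if k = B + H s p then none else some p, B + H s p, ?_, ?_, ?_, ?_, ?_, ?_⟩
    · simp only; rw [if_pos (by omega)]; simp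
    · intro i hi
      have e1 := htop i
      have e2 := htop (i + 1)
      have e3 := ho i
      have e4 := ho (i + 1)
      have e5 := hmS i
      have e6 := hmT i
      have e7 := hmT (i + 1)
      have e8 := hlt (i + 1) p
      have e9 : i = B + H s p → rk (2 * m) (n := n) H i none = H s p := by
        rintro rfl; exact hnT
      have e10 : i + 1 = B + H s p → rk (2 * m) (n := n) H (i + 1) none = H s p := by
        intro h; rw [h]; exact hnT
      simp only [hardWord, Set.mem_ofPred_eq]
      split_ifs <;> simp <;> omega
    · simp only
      rw [if_neg (by omega), if_pos trivial, if_neg (by omega), if_neg (by omega),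
        if_neg (by omega), if_neg (by omega)]
    · omega
    · omega
    · simp only
      rw [if_neg (by omega), if_neg (by omega), if_neg (by omega), if_pos trivial]

theorem freq_pigeon {T : Type} [Finite T] (P : ℕ → Prop) (v : ℕ → T)
    (hP : ∀ N, ∃ i, N ≤ i ∧ P i) : ∃ q, ∀ N, ∃ i, N ≤ i ∧ P i ∧ v i = q := by
  classical
  have := Fintype.ofFinite T
  by_contra hcon
  push Not at hcon
  choose N hN using hcon
  obtain ⟨i, hi, hPi⟩ := hP (Finset.univ.sup N)
  exact hN (v i) i ((Finset.le_sup (Finset.mem_univ _)).trans hi) hPi rfl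

theorem Lnm_le (n m : ℕ) (T : Type) [Fintype T] (C : NBW (FBAlpha n) T)
    (hC : C.Lang = (FB n).Langᶜ) : Lnm n m ≤ Fintype.card T := by
  unfold Lnm
  rcases isEmpty_or_nonempty {g : Fin (n - 1) → ℕ // QRanking n m g} with hE | hNE
  · simp
  have hfin : Finite {g : Fin (n - 1) → ℕ // QRanking n m g} := by
    apply Finite.of_injective
      (fun g : {g : Fin (n - 1) → ℕ // QRanking n m g} =>
        (fun q => (⟨g.1 q, g.2.1 q⟩ : Fin (2 * m))))
    intro g g' h
    ext q
    have := congrFun h q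
    simpa using this
  obtain ⟨e, he⟩ := exists_surjective_nat {g : Fin (n - 1) → ℕ // QRanking n m g}
  let R : ℕ → {g : Fin (n - 1) → ℕ // QRanking n m g} := fun i => e (Nat.unpair i).2
  have hR : ∀ f N, ∃ i, N ≤ i ∧ R i = f := by
    intro f N
    obtain ⟨j, hj⟩ := he f
    exact ⟨Nat.pair N j, Nat.left_le_pair _ _, by simp [R, hj]⟩
  let H : ℕ → Fin (n - 1) → ℕ := fun i => (R i).1
  have hH : ∀ i, QRanking n m (H i) := fun i => (R i).2
  have hmem : hardWord (2 * m) H ∈ C.Lang := by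
    rw [hC]; exact hardWord_not_mem _ _
  obtain ⟨ρ, h0, hρ, z, hz, hzF⟩ := hmem
  have hq : ∀ f, ∃ q, ∀ N, ∃ i, N ≤ i ∧ R i = f ∧ ρ (2 * (2 * m) * i + 2 * m) = q :=
    fun f => freq_pigeon _ (fun i => ρ (2 * (2 * m) * i + 2 * m)) (hR f)
  choose Q hQ using hq
  have key : ∀ f g, Q f = Q g → ∀ p, ¬ g.1 p < f.1 p := by
    intro f g hfg p hp
    have hm : 0 < m := by have := f.2.1 p; omega
    obtain ⟨s, -, hs, hsq⟩ := hQ f 0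
    obtain ⟨c, hc, hcz⟩ := hz (2 * (2 * m) * s + 2 * m)
    obtain ⟨t, ht, htg, htq⟩ := hQ g (s + c + 1)
    have hct : c < 2 * (2 * m) * t + 2 * m := by
      have : 1 * t ≤ 2 * (2 * m) * t := Nat.mul_le_mul_right _ (by omega)
      omega
    have hp' : H t p < H s p := by simpa [H, hs, htg] using hp
    obtain ⟨σ, d, hσ0, hσ, hσl, hd1, hd2, hd⟩ := loop_exists H hH s t (by omega) p hp'
    have m1 := lasso_mem C (hardWord (2 * m) H) ρ _ _ c (lt_of_le_of_lt hc hct) h0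
      (fun i _ => hρ i) (by rw [hsq, htq, hfg]) hc hct (by rw [hcz]; exact hzF)
    have m2 := lasso_mem (FB n) (hardWord (2 * m) H) σ _ _ d (lt_of_le_of_lt hc hct) hσ0
      hσ hσl hd1 hd2 hd
    rw [hC] at m1
    exact m1 m2
  have hinj : Function.Injective Q := by
    intro f g hfg
    ext p
    exact le_antisymm (not_lt.1 (key f g hfg p)) (not_lt.1 (key g f hfg.symm p))
  rw [← Nat.card_eq_fintype_card]
  exact Nat.card_le_card_of_injective Q hinj

/-- every NBW accepting the complement of `L(FB n)` has at least `L(n)` states. -/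
theorem buchi_complementation_lower_bound (n : ℕ) (hn : 1 < n)
    (T : Type) [Fintype T] (C : NBW (FBAlpha n) T) (hC : C.Lang = (FB n).Langᶜ) :
    Lmax n ≤ Fintype.card T := by
  exact Finset.sup_le (fun m _ => Lnm_le n m T C hC)

end YanPaper
end

section
/- For every n > 1 there exist an alphabet Γ with at most 7 letters and an NBW B_n over Γ with n states such that every NBW accepting the complement Γ^ω \ L(B_n) has at least L(n) states. -/
namespace YanPaper

section Aux

variable {A S : Type*}

/-- Path with exact flag for visiting `F` strictly after the start. -/
def Pth (M : NBW A S) : S → List A → S → Bool → Prop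
  | p, [], q, b => p = q ∧ b = false
  | p, a :: w, q, b => ∃ r b', M.Δ p a r ∧ Pth M r w q b' ∧ (b = true ↔ b' = true ∨ r ∈ M.F)

theorem pth_append (M : NBW A S) (u v : List A) (p q : S) (b : Bool) :
    Pth M p (u ++ v) q b ↔
      ∃ r b1 b2, Pth M p u r b1 ∧ Pth M r v q b2 ∧ (b = true ↔ b1 = true ∨ b2 = true) := by
  induction u generalizing p b with
  | nil =>
    simp only [List.nil_append, Pth]
    constructor
    · intro h
      exact ⟨p, false, b, ⟨rfl, rfl⟩, h, by simp⟩
    · rintro ⟨r, b1, b2, ⟨rfl, rfl⟩, h, hb⟩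
      have : b = b2 := by cases b <;> cases b2 <;> simp_all
      rwa [this]
  | cons a u ih =>
    simp only [List.cons_append, Pth, ih]
    constructor
    · rintro ⟨r, b', h1, ⟨r', b1, b2, h2, h3, h4⟩, h5⟩
      classical
      refine ⟨r', b1 || decide (r ∈ M.F), b2, ⟨r, b1, h1, h2, by simp⟩, h3, ?_⟩
      rw [h5, h4]; simp; tauto
    · rintro ⟨r', b1', b2, ⟨r, b1, h1, h2, h5⟩, h3, h4⟩
      refine ⟨r, b1 || b2, h1, ⟨r', b1, b2, h2, h3, by simp⟩, ?_⟩
      rw [h4, h5]; simp; tauto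

theorem pth_iff_run (M : NBW A S) (w : List A) (p q : S) (b : Bool) :
    Pth M p w q b ↔ ∃ ρ : ℕ → S, ρ 0 = p ∧ ρ w.length = q ∧
      (∀ i a, w[i]? = some a → M.Δ (ρ i) a (ρ (i + 1))) ∧
      (b = true ↔ ∃ i, i < w.length ∧ ρ (i + 1) ∈ M.F) := by
  induction w generalizing p b with
  | nil =>
    simp only [Pth]
    constructor
    · rintro ⟨rfl, rfl⟩
      exact ⟨fun _ => p, rfl, rfl, by simp, by simp⟩
    · rintro ⟨ρ, rfl, h, -, hb⟩
      refine ⟨h, ?_⟩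
      simpa using hb
  | cons a w ih =>
    simp only [Pth, ih]
    constructor
    · rintro ⟨r, b', h1, ⟨ρ, h2, h3, h4, h5⟩, h6⟩
      refine ⟨fun i => if i = 0 then p else ρ (i - 1), by simp, by simpa using h3, ?_, ?_⟩
      · intro i c hc
        cases i with
        | zero => simp at hc; subst hc; simpa [h2] using h1
        | succ i => simp at hc; simpa using h4 i c hc
      · rw [h6, h5]
        constructor
        · rintro (⟨i, hi, h⟩ | h)
          · exact ⟨i + 1, by simpa using hi, by simpa using h⟩
          · exact ⟨0, by simp, by simpa [h2] using h⟩
        · rintro ⟨i, hi, h⟩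
          cases i with
          | zero => right; simpa [h2] using h
          | succ i => left; exact ⟨i, by simpa using hi, by simpa using h⟩
    · rintro ⟨ρ, h1, h2, h3, h4⟩
      classical
      refine ⟨ρ 1, decide (∃ i, i < w.length ∧ ρ (i + 1 + 1) ∈ M.F), ?_,
        ⟨fun i => ρ (i + 1), rfl, by simpa using h2, ?_, by simp⟩, ?_⟩
      · have := h3 0 a (by simp)
        simpa [h1] using this
      · intro i c hc
        exact h3 (i + 1) c (by simpa using hc)
      · rw [h4]
        constructor
        · rintro ⟨i, hi, h⟩
          cases i with
          | zero => right; simpa using h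
          | succ i => left; simp only [decide_eq_true_eq]; exact ⟨i, by simpa using hi, h⟩
        · rintro (h | h)
          · simp only [decide_eq_true_eq] at h
            obtain ⟨i, hi, h⟩ := h
            exact ⟨i + 1, by simpa using hi, h⟩
          · exact ⟨0, by simp, h⟩

/-- Position decoding for an infinite concatenation. -/
def dec (w : ℕ → List A) : ℕ → ℕ × ℕ
  | 0 => (0, 0)
  | n + 1 => if (dec w n).2 + 1 < (w (dec w n).1).length then ((dec w n).1, (dec w n).2 + 1)
      else ((dec w n).1 + 1, 0)

def cpos (w : ℕ → List A) : ℕ → ℕ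
  | 0 => 0
  | k + 1 => cpos w k + (w k).length

theorem dec_lt (w : ℕ → List A) (hw : ∀ k, w k ≠ []) (n : ℕ) :
    (dec w n).2 < (w (dec w n).1).length := by
  cases n with
  | zero => exact List.length_pos_iff.2 (hw _)
  | succ n =>
    simp only [dec]
    split_ifs with h
    · exact h
    · exact List.length_pos_iff.2 (hw _)

theorem dec_pos (w : ℕ → List A) (hw : ∀ k, w k ≠ []) (n : ℕ) :
    n = cpos w (dec w n).1 + (dec w n).2 := by
  induction n with
  | zero => simp [dec, cpos]
  | succ n ih =>
    have := dec_lt w hw n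
    simp only [dec]
    split_ifs with h
    · simp only; omega
    · simp only [cpos]; omega

theorem cpos_add (w : ℕ → List A) (hw : ∀ k, w k ≠ []) (k t : ℕ) (ht : t < (w k).length) :
    dec w (cpos w k + t) = (k, t) := by
  induction k generalizing t with
  | zero =>
    induction t with
    | zero => simp [dec, cpos]
    | succ t ih =>
      have := ih (by omega)
      rw [← Nat.add_assoc, dec, this, if_pos ht]
  | succ k ihk =>
    induction t with
    | zero =>
      have h0 : 0 < (w k).length := List.length_pos_iff.2 (hw _)
      have := ihk ((w k).length - 1) (by omega)
      have e : cpos w (k + 1) + 0 = cpos w k + ((w k).length - 1) + 1 := by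
        simp only [cpos]; omega
      rw [e, dec, this, if_neg (by simp only; omega)]
    | succ t ih =>
      have := ih (by omega)
      rw [← Nat.add_assoc, dec, this, if_pos ht]

theorem cpos_mono (w : ℕ → List A) {a b : ℕ} (h : a ≤ b) : cpos w a ≤ cpos w b := by
  induction b, h using Nat.le_induction with
  | base => rfl
  | succ b _ ih => simp only [cpos]; omega

theorem le_cpos (w : ℕ → List A) (hw : ∀ k, w k ≠ []) (k : ℕ) : k ≤ cpos w k := by
  induction k with
  | zero => simp
  | succ k ih =>
    have h0 : 0 < (w k).length := List.length_pos_iff.2 (hw _)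
    simp only [cpos]; omega

/-- `α` is the infinite concatenation of the words `w k`. -/
def IsConcat (w : ℕ → List A) (α : ℕ → A) : Prop :=
  ∀ n, (w (dec w n).1)[(dec w n).2]? = some (α n)

theorem exists_concat (w : ℕ → List A) (hw : ∀ k, w k ≠ []) : ∃ α, IsConcat w α :=
  ⟨fun n => (w (dec w n).1)[(dec w n).2]'(dec_lt w hw n), fun n => by
    simp [dec_lt w hw n]⟩

theorem concat_mem (M : NBW A S) [Finite S] (w : ℕ → List A) (hw : ∀ k, w k ≠ [])
    (α : ℕ → A) (hα : IsConcat w α) :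
    α ∈ M.Lang ↔ ∃ (s : ℕ → S) (b : ℕ → Bool), s 0 ∈ M.I ∧
      (∀ k, Pth M (s k) (w k) (s (k + 1)) (b k)) ∧ ∀ K, ∃ k, K ≤ k ∧ b k = true := by
  constructor
  · rintro ⟨ρ, h0, hρ, x, hx, hxF⟩
    classical
    refine ⟨fun k => ρ (cpos w k), fun k => decide (∃ i, i < (w k).length ∧
      ρ (cpos w k + (i + 1)) ∈ M.F), by simpa [cpos] using h0, ?_, ?_⟩
    · intro k
      rw [pth_iff_run]
      refine ⟨fun i => ρ (cpos w k + i), rfl, rfl, ?_, by simp⟩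
      intro i a ha
      have hi : i < (w k).length := by
        by_contra hcon
        rw [List.getElem?_eq_none (by omega)] at ha
        exact absurd ha (by simp)
      have h1 := hα (cpos w k + i)
      rw [cpos_add w hw k i hi] at h1
      simp only [ha, Option.some.injEq] at h1
      subst h1
      exact hρ _
    · intro K
      obtain ⟨n, hn, hnx⟩ := hx (cpos w K + 1)
      obtain ⟨l, rfl⟩ : ∃ l, n = l + 1 := ⟨n - 1, by omega⟩
      have h1 := dec_pos w hw l
      have h2 := dec_lt w hw l
      refine ⟨(dec w l).1, ?_, ?_⟩
      · by_contra hcon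
        have := cpos_mono w (show (dec w l).1 + 1 ≤ K by omega)
        simp only [cpos] at this
        omega
      · simp only [decide_eq_true_eq]
        refine ⟨(dec w l).2, h2, ?_⟩
        rw [← Nat.add_assoc, ← h1, hnx]
        exact hxF
  · rintro ⟨s, b, h0, hP, hb⟩
    have hP' := fun k => (pth_iff_run M _ _ _ _).1 (hP k)
    choose ρ hρ0 hρ1 hρ2 hρ3 using hP'
    have key : ∀ n, ρ (dec w (n + 1)).1 (dec w (n + 1)).2
        = ρ (dec w n).1 ((dec w n).2 + 1) := by
      intro n
      have := dec_lt w hw n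
      simp only [dec]
      split_ifs with h
      · rfl
      · simp only
        rw [hρ0, ← hρ1]
        congr 1
        omega
    have hinf : ∀ K, ∃ n, K ≤ n ∧ ρ (dec w n).1 (dec w n).2 ∈ M.F := by
      intro K
      obtain ⟨k, hk, hbk⟩ := hb K
      obtain ⟨i, hi, hF⟩ := (hρ3 k).1 hbk
      refine ⟨cpos w k + i + 1, ?_, ?_⟩
      · have := le_cpos w hw k
        omega
      · rw [key, cpos_add w hw k i hi]
        exact hF
    refine ⟨fun n => ρ (dec w n).1 (dec w n).2, by simpa [dec, hρ0] using h0, ?_, ?_⟩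
    · intro n
      simp only [key]
      exact hρ2 _ _ _ (hα n)
    · by_contra hcon
      have h1 : ∀ x : S, ∃ N, x ∈ M.F → ∀ n, N ≤ n → ρ (dec w n).1 (dec w n).2 ≠ x := by
        intro x
        by_cases hx : x ∈ M.F
        · by_contra hc
          push Not at hc
          exact hcon ⟨x, fun N => (hc N).2, hx⟩
        · exact ⟨0, fun h => absurd h hx⟩
      choose N hN using h1
      have := Fintype.ofFinite S
      obtain ⟨n, hn, hF⟩ := hinf (Finset.univ.sup N)
      exact hN _ hF n ((Finset.le_sup (Finset.mem_univ _)).trans hn) rfl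

end Aux

section Letters

variable {N : ℕ}

/-- The seven letters. -/
def letterRel (σ τ : Equiv.Perm (Fin N)) (x y : Fin N) (a : Fin 7)
    (p q : Option (Fin N)) : Prop :=
  match a with
  | 0 => ∃ z, p = some z ∧ q = some z
  | 1 => ∃ z, p = some z ∧ q = some (σ z)
  | 2 => ∃ z, p = some z ∧ q = some (τ z)
  | 3 => ∃ z, p = some z ∧ q = some z ∧ z ≠ x
  | 4 => (∃ z, p = some z ∧ q = some z) ∨ (p = some x ∧ q = some y)
  | 5 => (∃ z, p = some z ∧ q = some z) ∨ (p = some x ∧ q = none)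
  | 6 => (∃ z, p = some z ∧ q = some z) ∨ (p = none ∧ q = some y)

def Bt (σ τ : Equiv.Perm (Fin N)) (x y : Fin N) : NBW (Fin 7) (Option (Fin N)) where
  I := {s | s ≠ none}
  Δ := fun p a q => letterRel σ τ x y a p q
  F := {none}

/-- `R` is the relation on main states realized by some word. -/
def Real (M : NBW (Fin 7) (Option (Fin N))) (R : Fin N → Bool → Fin N → Prop) : Prop :=
  ∃ w, ∀ p q' b, Pth M (some p) w q' b ↔ ∃ q, q' = some q ∧ R p b q

def comp (R T : Fin N → Bool → Fin N → Prop) : Fin N → Bool → Fin N → Prop :=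
  fun p b q => ∃ r b1 b2, R p b1 r ∧ T r b2 q ∧ (b = true ↔ b1 = true ∨ b2 = true)

theorem real_comp {M : NBW (Fin 7) (Option (Fin N))} {R T} (hR : Real M R) (hT : Real M T) :
    Real M (comp R T) := by
  obtain ⟨u, hu⟩ := hR
  obtain ⟨v, hv⟩ := hT
  refine ⟨u ++ v, fun p q' b => ?_⟩
  rw [pth_append]
  constructor
  · rintro ⟨r', b1, b2, h1, h2, h3⟩
    obtain ⟨r, rfl, hr⟩ := (hu _ _ _).1 h1
    obtain ⟨q, rfl, hq⟩ := (hv _ _ _).1 h2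
    exact ⟨q, rfl, r, b1, b2, hr, hq, h3⟩
  · rintro ⟨q, rfl, r, b1, b2, hr, hq, h3⟩
    exact ⟨some r, b1, b2, (hu _ _ _).2 ⟨r, rfl, hr⟩, (hv _ _ _).2 ⟨q, rfl, hq⟩, h3⟩

theorem real_congr {M : NBW (Fin 7) (Option (Fin N))} {R T} (hR : Real M R)
    (h : ∀ p b q, R p b q ↔ T p b q) : Real M T := by
  have : R = T := by
    funext p b q
    exact propext (h p b q)
  rwa [← this]

theorem real_one (M : NBW (Fin 7) (Option (Fin N))) :
    Real M (fun p b q => b = false ∧ p = q) := by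
  refine ⟨[], fun p q' b => ?_⟩
  simp only [Pth]
  constructor
  · rintro ⟨rfl, h⟩; exact ⟨p, rfl, h, rfl⟩
  · rintro ⟨q, rfl, h, rfl⟩; exact ⟨rfl, h⟩

variable (σ τ : Equiv.Perm (Fin N)) (x y : Fin N)

theorem pth_single (M : NBW (Fin 7) (Option (Fin N))) (hF : M.F = {none}) (a : Fin 7)
    (p q : Option (Fin N)) (b : Bool) :
    Pth M p [a] q b ↔ M.Δ p a q ∧ (b = true ↔ q = none) := by
  simp only [Pth, hF]
  constructor
  · rintro ⟨r, b', h, ⟨rfl, rfl⟩, hb⟩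
    exact ⟨h, by simpa using hb⟩
  · rintro ⟨h, hb⟩
    exact ⟨q, false, h, ⟨rfl, rfl⟩, by simpa using hb⟩

theorem real_single (a : Fin 7) (T : Fin N → Fin N → Prop)
    (h : ∀ p q', letterRel σ τ x y a (some p) q' ↔ ∃ q, q' = some q ∧ T p q) :
    Real (Bt σ τ x y) (fun p b q => b = false ∧ T p q) := by
  refine ⟨[a], fun p q' b => ?_⟩
  rw [pth_single _ rfl]
  change letterRel σ τ x y a (some p) q' ∧ _ ↔ _
  rw [h]
  constructor
  · rintro ⟨⟨q, rfl, hq⟩, hb⟩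
    exact ⟨q, rfl, by simpa using hb, hq⟩
  · rintro ⟨q, rfl, hb, hq⟩
    exact ⟨⟨q, rfl, hq⟩, by simpa using hb⟩

theorem real_sigma : Real (Bt σ τ x y) (fun p b q => b = false ∧ q = σ p) :=
  real_single σ τ x y 1 _ (by intro p q'; simp [letterRel])

theorem real_tau : Real (Bt σ τ x y) (fun p b q => b = false ∧ q = τ p) :=
  real_single σ τ x y 2 _ (by intro p q'; simp [letterRel])

theorem real_del : Real (Bt σ τ x y) (fun p b q => b = false ∧ (p = q ∧ p ≠ x)) :=
  real_single σ τ x y 3 _ (by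
    intro p q'
    simp only [letterRel]
    constructor
    · rintro ⟨z, h, rfl, hz⟩
      cases h; exact ⟨p, rfl, rfl, hz⟩
    · rintro ⟨q, rfl, rfl, hz⟩
      exact ⟨p, rfl, rfl, hz⟩)

theorem real_copy : Real (Bt σ τ x y) (fun p b q => b = false ∧ (p = q ∨ (p = x ∧ q = y))) :=
  real_single σ τ x y 4 _ (by
    intro p q'
    simp only [letterRel]
    constructor
    · rintro (⟨z, h, rfl⟩ | ⟨h, rfl⟩)
      · cases h; exact ⟨p, rfl, Or.inl rfl⟩
      · cases h; exact ⟨y, rfl, Or.inr ⟨rfl, rfl⟩⟩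
    · rintro ⟨q, rfl, rfl | ⟨rfl, rfl⟩⟩
      · exact Or.inl ⟨p, rfl, rfl⟩
      · exact Or.inr ⟨rfl, rfl⟩)

theorem real_visit : Real (Bt σ τ x y)
    (fun p b q => (b = false ∧ p = q) ∨ (b = true ∧ p = x ∧ q = y)) := by
  refine ⟨[5] ++ [6], fun p q' b => ?_⟩
  rw [pth_append]
  simp only [pth_single (Bt σ τ x y) rfl]
  simp only [Bt, letterRel]
  constructor
  · rintro ⟨r, b1, b2, ⟨h1, hb1⟩, ⟨h2, hb2⟩, hb⟩
    rcases h1 with ⟨z, h, rfl⟩ | ⟨h, rfl⟩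
    · cases h
      rcases h2 with ⟨z, h, rfl⟩ | ⟨h, rfl⟩
      · cases h
        refine ⟨p, rfl, Or.inl ⟨?_, rfl⟩⟩
        simp at hb1 hb2; simpa [hb1, hb2] using hb
      · cases h
    · cases h
      rcases h2 with ⟨z, h, rfl⟩ | ⟨h, rfl⟩
      · cases h
      · refine ⟨y, rfl, Or.inr ⟨?_, rfl, rfl⟩⟩
        simp at hb1 hb2; simpa [hb1, hb2] using hb
  · rintro ⟨q, rfl, ⟨rfl, rfl⟩ | ⟨rfl, rfl, rfl⟩⟩
    · exact ⟨some p, false, false, ⟨Or.inl ⟨p, rfl, rfl⟩, by simp⟩,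
        ⟨Or.inl ⟨p, rfl, rfl⟩, by simp⟩, by simp⟩
    · exact ⟨none, true, false, ⟨Or.inr ⟨rfl, rfl⟩, by simp⟩,
        ⟨Or.inr ⟨rfl, rfl⟩, by simp⟩, by simp⟩

variable {σ τ x y}

theorem real_perm (hg : Submonoid.closure ({σ, τ} : Set (Equiv.Perm (Fin N))) = ⊤)
    (π : Equiv.Perm (Fin N)) :
    Real (Bt σ τ x y) (fun p b q => b = false ∧ q = π p) := by
  have hπ : π ∈ Submonoid.closure ({σ, τ} : Set (Equiv.Perm (Fin N))) := by rw [hg]; trivial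
  induction hπ using Submonoid.closure_induction with
  | mem z hz =>
    rcases hz with rfl | rfl
    · exact real_sigma _ _ _ _
    · exact real_tau _ _ _ _
  | one => exact real_congr (real_one _) (fun p b q => and_congr_right fun _ => eq_comm)
  | mul a b _ _ ha hb =>
    refine real_congr (real_comp hb ha) ?_
    intro p b q
    simp [comp]

theorem real_conj (hg : Submonoid.closure ({σ, τ} : Set (Equiv.Perm (Fin N))) = ⊤)
    {R} (hR : Real (Bt σ τ x y) R) (π : Equiv.Perm (Fin N)) :
    Real (Bt σ τ x y) (fun p b q => R (π p) b (π q)) := by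
  refine real_congr (real_comp (real_perm hg π) (real_comp hR (real_perm hg π⁻¹))) ?_
  intro p b q
  simp only [comp]
  constructor
  · rintro ⟨r, b1, b2, ⟨rfl, rfl⟩, ⟨r', b3, b4, h, ⟨rfl, rfl⟩, h1⟩, h2⟩
    have : b = b3 := by
      clear h
      revert h1 h2
      cases b <;> cases b2 <;> cases b3 <;> simp
    subst this
    simpa using h
  · intro h
    exact ⟨π p, false, b, ⟨rfl, rfl⟩, ⟨π q, b, false, h, ⟨rfl, by simp⟩, by simp⟩, by simp⟩

theorem exists_perm_extend {ι : Type} [Finite ι] (u v : ι → Fin N) (hu : Function.Injective u)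
    (hv : Function.Injective v) : ∃ π : Equiv.Perm (Fin N), ∀ i, π (u i) = v i := by
  classical
  have := Fintype.ofFinite ι
  let e : {a // a ∈ Set.range u} ≃ {a // a ∈ Set.range v} :=
    (Equiv.ofInjective u hu).symm.trans (Equiv.ofInjective v hv)
  refine ⟨e.extendSubtype, fun i => ?_⟩
  rw [Equiv.extendSubtype_apply_of_mem e (u i) ⟨i, rfl⟩]
  have : (Equiv.ofInjective u hu).symm ⟨u i, ⟨i, rfl⟩⟩ = i := by
    rw [Equiv.symm_apply_eq]; rfl
  simp only [e, Equiv.trans_apply, this]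
  rfl

/-- hypotheses on the generators -/
structure Gen (σ τ : Equiv.Perm (Fin N)) (x y : Fin N) : Prop where
  gen : Submonoid.closure ({σ, τ} : Set (Equiv.Perm (Fin N))) = ⊤
  ne : ∀ p q : Fin N, p ≠ q → x ≠ y

theorem Gen.pair (h : Gen σ τ x y) {p q : Fin N} (hpq : p ≠ q) :
    ∃ π : Equiv.Perm (Fin N), π p = x ∧ π q = y := by
  have hne := h.ne p q hpq
  obtain ⟨π, hπ⟩ := exists_perm_extend (fun b : Bool => if b then p else q)
    (fun b : Bool => if b then x else y)
    (by intro a b; cases a <;> cases b <;> simp [hpq, hpq.symm])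
    (by intro a b; cases a <;> cases b <;> simp [hne, hne.symm])
  exact ⟨π, by simpa using hπ true, by simpa using hπ false⟩

theorem Gen.copy (h : Gen σ τ x y) {p q : Fin N} (hpq : p ≠ q) :
    Real (Bt σ τ x y) (fun a b c => b = false ∧ (a = c ∨ (a = p ∧ c = q))) := by
  obtain ⟨π, rfl, rfl⟩ := h.pair hpq
  exact real_congr (real_conj h.gen (real_copy σ τ _ _) π) (by intro a b c; simp)

theorem Gen.visit (h : Gen σ τ x y) {p q : Fin N} (hpq : p ≠ q) :
    Real (Bt σ τ x y) (fun a b c => (b = false ∧ a = c) ∨ (b = true ∧ a = p ∧ c = q)) := by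
  obtain ⟨π, rfl, rfl⟩ := h.pair hpq
  exact real_congr (real_conj h.gen (real_visit σ τ _ _) π) (by intro a b c; simp)

theorem Gen.del (h : Gen σ τ x y) (l : List (Fin N)) :
    Real (Bt σ τ x y) (fun a b c => b = false ∧ a = c ∧ a ∉ l) := by
  induction l with
  | nil => exact real_congr (real_one _) (by simp)
  | cons p l ih =>
    have h1 := real_conj h.gen (real_del σ τ x y) (Equiv.swap p x)
    refine real_congr (real_comp h1 ih) ?_
    intro a b c
    have e : ∀ a, Equiv.swap p x a = x ↔ a = p := by
      intro a
      rw [Equiv.swap_apply_eq_iff]; simp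
    simp only [comp, ne_eq, e, List.mem_cons, EmbeddingLike.apply_eq_iff_eq]
    constructor
    · rintro ⟨r, b1, b2, ⟨rfl, rfl, h1⟩, ⟨rfl, rfl, h2⟩, h3⟩
      exact ⟨by simpa using h3, rfl, by tauto⟩
    · rintro ⟨rfl, rfl, h1⟩
      exact ⟨a, false, false, ⟨rfl, rfl, by tauto⟩, ⟨rfl, rfl, by tauto⟩, by simp⟩

def Sound (f g : Fin N → ℕ) (R : Fin N → Bool → Fin N → Prop) : Prop :=
  ∀ p b q, R p b q → g q ≤ f p ∧ (b = true → g q < f p)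

theorem sound_comp {f g k : Fin N → ℕ} {R T} (h1 : Sound f g R) (h2 : Sound g k T) :
    Sound f k (comp R T) := by
  rintro p b q ⟨r, b1, b2, hR, hT, hb⟩
  have a1 := h1 _ _ _ hR
  have a2 := h2 _ _ _ hT
  refine ⟨a2.1.trans a1.1, fun h => ?_⟩
  rcases hb.1 h with h | h
  · exact a2.1.trans_lt (a1.2 h)
  · exact (a2.2 h).trans_le a1.1

theorem Gen.full_list (h : Gen σ τ x y) (f : Fin N → ℕ) (l : List (Fin N × Fin N)) :
    ∃ R, Real (Bt σ τ x y) R ∧ Sound f f R ∧ (∀ p, R p false p) ∧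
      ∀ z ∈ l, (f z.2 < f z.1 → R z.1 true z.2) ∧ (f z.2 = f z.1 → R z.1 false z.2) := by
  induction l with
  | nil =>
    refine ⟨_, real_one _, ?_, by simp, by simp⟩
    rintro p b q ⟨rfl, rfl⟩
    simp
  | cons z l ih =>
    obtain ⟨R, hR, hs, hid, hl⟩ := ih
    obtain ⟨p, q⟩ := z
    rcases lt_trichotomy (f q) (f p) with hlt | heq | hgt
    · have hne : p ≠ q := by rintro rfl; omega
      refine ⟨_, real_comp (h.visit hne) hR, sound_comp ?_ hs, ?_, ?_⟩
      · rintro a b c (⟨rfl, rfl⟩ | ⟨rfl, rfl, rfl⟩)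
        · simp
        · exact ⟨hlt.le, fun _ => hlt⟩
      · intro a
        exact ⟨a, false, false, Or.inl ⟨rfl, rfl⟩, hid a, by simp⟩
      · intro z hz
        rcases List.mem_cons.1 hz with rfl | hz
        · exact ⟨fun _ => ⟨q, true, false, Or.inr ⟨rfl, rfl, rfl⟩, hid q, by simp⟩,
            fun h => by simp only at h; omega⟩
        · exact ⟨fun h => ⟨z.1, false, true, Or.inl ⟨rfl, rfl⟩, (hl z hz).1 h, by simp⟩,
            fun h => ⟨z.1, false, false, Or.inl ⟨rfl, rfl⟩, (hl z hz).2 h, by simp⟩⟩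
    · by_cases hne : p = q
      · subst hne
        refine ⟨R, hR, hs, hid, ?_⟩
        intro z hz
        rcases List.mem_cons.1 hz with rfl | hz
        · exact ⟨fun h => absurd h (lt_irrefl _), fun _ => hid _⟩
        · exact hl z hz
      refine ⟨_, real_comp (h.copy hne) hR, sound_comp ?_ hs, ?_, ?_⟩
      · rintro a b c ⟨rfl, rfl | ⟨rfl, rfl⟩⟩
        · simp
        · exact ⟨heq.le, by simp⟩
      · intro a
        exact ⟨a, false, false, ⟨rfl, Or.inl rfl⟩, hid a, by simp⟩
      · intro z hz
        rcases List.mem_cons.1 hz with rfl | hz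
        · exact ⟨fun h => by simp only at h; omega,
            fun _ => ⟨q, false, false, ⟨rfl, Or.inr ⟨rfl, rfl⟩⟩, hid q, by simp⟩⟩
        · exact ⟨fun h => ⟨z.1, false, true, ⟨rfl, Or.inl rfl⟩, (hl z hz).1 h, by simp⟩,
            fun h => ⟨z.1, false, false, ⟨rfl, Or.inl rfl⟩, (hl z hz).2 h, by simp⟩⟩
    · refine ⟨R, hR, hs, hid, ?_⟩
      intro z hz
      rcases List.mem_cons.1 hz with rfl | hz
      · exact ⟨fun h => by simp only at h; omega, fun h => by simp only at h; omega⟩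
      · exact hl z hz

theorem Gen.full (h : Gen σ τ x y) (f : Fin N → ℕ) :
    ∃ R, Real (Bt σ τ x y) R ∧ Sound f f R ∧
      ∀ p q, (f q < f p → R p true q) ∧ (f q = f p → R p false q) := by
  obtain ⟨R, h1, h2, -, h3⟩ := h.full_list f Finset.univ.toList
  exact ⟨R, h1, h2, fun p q => h3 (p, q) (by simp)⟩

def QR (m : ℕ) (g : Fin N → ℕ) : Prop :=
  (∀ q, g q < 2 * m) ∧ ∀ r, r < 2 * m → Odd r → ∃ q, g q = r

theorem exists_odd_between {m a b : ℕ} (hb : b < 2 * m) (h : a < b ∨ (a = b ∧ Odd b)) :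
    ∃ i : Fin m, a ≤ 2 * i.1 + 1 ∧ 2 * i.1 + 1 ≤ b := by
  rcases h with h | ⟨rfl, k, rfl⟩
  · rcases Nat.even_or_odd' b with ⟨k, rfl | rfl⟩
    · exact ⟨⟨k - 1, by omega⟩, by simp only; omega, by simp only; omega⟩
    · exact ⟨⟨k, by omega⟩, by simp only; omega, by simp only; omega⟩
  · exact ⟨⟨k, by omega⟩, by simp only; omega, by simp only; omega⟩

theorem Gen.seg (h : Gen σ τ x y) {m : ℕ} (f g : Fin N → ℕ) (hf : QR m f) (hg : QR m g) :
    ∃ w : List (Fin 7), w ≠ [] ∧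
      (∀ p q' b, Pth (Bt σ τ x y) (some p) w q' b →
        ∃ q, q' = some q ∧ g q ≤ f p ∧ (b = true → g q < f p)) ∧
      (∀ p q, g q < f p → Pth (Bt σ τ x y) (some p) w (some q) true) ∧
      (∀ p q, g q = f p → Odd (f p) → Pth (Bt σ τ x y) (some p) w (some q) false) := by
  have hu : ∀ i : Fin m, ∃ a, f a = 2 * i.1 + 1 := fun i => hf.2 _ (by omega) ⟨i, rfl⟩
  have hv : ∀ i : Fin m, ∃ a, g a = 2 * i.1 + 1 := fun i => hg.2 _ (by omega) ⟨i, rfl⟩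
  choose u hu using hu
  choose v hv using hv
  obtain ⟨π, hπ⟩ := exists_perm_extend u v
    (by intro i j hij; have := hu i; rw [hij, hu] at this; exact Fin.ext (by omega))
    (by intro i j hij; have := hv i; rw [hij, hv] at this; exact Fin.ext (by omega))
  classical
  obtain ⟨R, hR, hRs, hRc⟩ := h.full f
  obtain ⟨T, hT, hTs, hTc⟩ := h.full g
  have hD := h.del (Finset.univ.filter (fun a => a ∉ Set.range u)).toList
  have hP := real_perm (x := x) (y := y) h.gen π
  have hmid : Sound f g (comp (fun a b c => b = false ∧ a = c ∧
      a ∉ (Finset.univ.filter (fun a => a ∉ Set.range u)).toList)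
      (fun p b q => b = false ∧ q = π p)) := by
    rintro p b q ⟨r, b1, b2, ⟨rfl, rfl, h1⟩, ⟨rfl, rfl⟩, h3⟩
    simp only [Finset.mem_toList, Finset.mem_filter, Finset.mem_univ, true_and, not_not] at h1
    obtain ⟨i, rfl⟩ := h1
    rw [hπ, hu, hv]
    simp at h3
    simp [h3]
  have hmidc : ∀ i, (comp (fun a b c => b = false ∧ a = c ∧
      a ∉ (Finset.univ.filter (fun a => a ∉ Set.range u)).toList)
      (fun p b q => b = false ∧ q = π p)) (u i) false (v i) := by
    intro i
    exact ⟨u i, false, false, ⟨rfl, rfl, by simp⟩, ⟨rfl, (hπ i).symm⟩, by simp⟩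
  have hs := sound_comp hRs (sound_comp hmid hTs)
  obtain ⟨w, hw⟩ := real_comp hR (real_comp (real_comp hD hP) hT)
  have h0 : ∀ p q b, Pth (Bt σ τ x y) (some p) (0 :: w) q b ↔
      Pth (Bt σ τ x y) (some p) w q b := by
    intro p q b
    simp only [Pth]
    constructor
    · rintro ⟨r, b', h1, h2, h3⟩
      obtain ⟨z, h4, rfl⟩ := h1
      cases h4
      have : b = b' := by cases b <;> cases b' <;> simp_all [Bt]
      rwa [this]
    · intro h
      exact ⟨some p, b, ⟨p, rfl, rfl⟩, h, by simp [Bt]⟩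
  refine ⟨0 :: w, by simp, ?_, ?_, ?_⟩
  · intro p q' b hp
    obtain ⟨q, rfl, hq⟩ := (hw _ _ _).1 ((h0 _ _ _).1 hp)
    exact ⟨q, rfl, hs _ _ _ hq⟩
  · intro p q hpq
    rw [h0, hw]
    refine ⟨q, rfl, ?_⟩
    obtain ⟨i, hi1, hi2⟩ := exists_odd_between (hf.1 p) (Or.inl hpq)
    by_cases hlt : 2 * i.1 + 1 < f p
    · have a1 := (hRc p (u i)).1 (by rw [hu]; exact hlt)
      by_cases hlt2 : g q < 2 * i.1 + 1
      · have a2 := (hTc (v i) q).1 (by rw [hv]; exact hlt2)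
        exact ⟨_, _, true, a1, ⟨_, _, true, hmidc i, a2, by simp⟩, by simp⟩
      · have a2 := (hTc (v i) q).2 (by rw [hv]; omega)
        exact ⟨_, _, false, a1, ⟨_, _, _, hmidc i, a2, by simp⟩, by simp⟩
    · have a1 := (hRc p (u i)).2 (by rw [hu]; omega)
      have a2 := (hTc (v i) q).1 (by rw [hv]; omega)
      exact ⟨_, _, true, a1, ⟨_, _, _, hmidc i, a2, by simp⟩, by simp⟩
  · intro p q hpq ho
    rw [h0, hw]
    refine ⟨q, rfl, ?_⟩
    obtain ⟨i, hi1, hi2⟩ := exists_odd_between (hf.1 p) (Or.inr ⟨hpq, ho⟩)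
    have a1 := (hRc p (u i)).2 (by rw [hu]; omega)
    have a2 := (hTc (v i) q).2 (by rw [hv]; omega)
    exact ⟨_, _, false, a1, ⟨_, _, _, hmidc i, a2, by simp⟩, by simp⟩

theorem exists_gen (hN : 0 < N) : ∃ (σ τ : Equiv.Perm (Fin N)) (x y : Fin N), Gen σ τ x y := by
  obtain _ | _ | N := N
  · omega
  · have : Subsingleton (Fin (0 + 1)) := inferInstanceAs (Subsingleton (Fin 1))
    refine ⟨1, 1, 0, 0, ?_, fun p q h => absurd (Subsingleton.elim p q) h⟩
    rw [eq_top_iff]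
    intro z _
    rw [Subsingleton.elim z 1]
    exact one_mem _
  · refine ⟨finRotate (N + 2), Equiv.swap 0 (finRotate (N + 2) 0), 0, 1, ?_, fun p q h => by simp⟩
    rw [← Subgroup.closure_toSubmonoid_of_finite,
      Equiv.Perm.closure_cycle_adjacent_swap isCycle_finRotate support_finRotate]
    rfl

end Letters

section Main

/-- Looping index sequence. -/
def lp (j i : ℕ) : ℕ → ℕ
  | 0 => 0
  | k + 1 => if lp j i k + 1 = i then j else lp j i k + 1

theorem lp_lt {j i : ℕ} (h : j < i) (k : ℕ) : lp j i k < i := by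
  induction k with
  | zero => simp only [lp]; omega
  | succ k ih => simp only [lp]; split_ifs <;> omega

theorem lp_add {j i : ℕ} (k d : ℕ) (hd : lp j i k + d < i) :
    lp j i (k + d) = lp j i k + d := by
  induction d with
  | zero => rfl
  | succ d ih =>
    have := ih (by omega)
    rw [← Nat.add_assoc, lp, this, if_neg (by omega), Nat.add_assoc]

theorem lp_inf {j i : ℕ} (h : j < i) (c : ℕ) (h1 : j ≤ c) (h2 : c < i) (K : ℕ) :
    ∃ k, K ≤ k ∧ lp j i k = c := by
  have a := lp_lt h K
  have b := lp_add (j := j) (i := i) K (i - 1 - lp j i K) (by omega)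
  have e : lp j i (K + (i - 1 - lp j i K) + 1) = j := by
    rw [lp, if_pos (by omega)]
  have e2 := lp_add (j := j) (i := i) (K + (i - 1 - lp j i K) + 1) (c - j) (by omega)
  refine ⟨_, ?_, e2.trans (by omega)⟩
  omega

variable {N : ℕ} {σ τ : Equiv.Perm (Fin N)} {x y : Fin N}

theorem main_bound (h : Gen σ τ x y) {m : ℕ} (hm : 1 ≤ m) (T : Type) [Fintype T]
    (C : NBW (Fin 7) T) (hC : C.Lang = (Bt σ τ x y).Langᶜ) :
    Nat.card {g : Fin N → ℕ // QR m g} ≤ Fintype.card T := by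
  classical
  rcases isEmpty_or_nonempty {g : Fin N → ℕ // QR m g} with hE | hE
  · simp
  obtain ⟨e, he⟩ := exists_surjective_nat ({g : Fin N → ℕ // QR m g} × ℕ)
  obtain ⟨r, hr⟩ : ∃ r : ℕ → {g : Fin N → ℕ // QR m g}, ∀ g K, ∃ k, K ≤ k ∧ r k = g := by
    refine ⟨fun k => (e k).1, fun g K => ?_⟩
    by_contra hcon
    push Not at hcon
    choose s hs using fun i => he (g, i)
    have hinj : Function.Injective s := by
      intro a b hab
      have := hs a
      rw [hab, hs b] at this
      simpa using this.symm
    obtain ⟨k, hk⟩ := (Set.infinite_range_of_injective hinj).exists_gt K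
    obtain ⟨⟨i, rfl⟩, hk⟩ := hk
    exact hcon (s i) hk.le (by rw [hs])
  choose W hW0 hWs hWt hWf using fun k => h.seg (r k).1 (r (k + 1)).1 (r k).2 (r (k + 1)).2
  -- general rejection
  obtain ⟨α, hα⟩ := exists_concat W hW0
  have hrej : α ∉ (Bt σ τ x y).Lang := by
    rw [concat_mem _ W hW0 α hα]
    rintro ⟨s, b, h0, hP, hb⟩
    have hmain : ∀ k, ∃ p, s k = some p := by
      intro k
      induction k with
      | zero => exact Option.ne_none_iff_exists'.1 h0
      | succ k ih =>
        obtain ⟨p, hp⟩ := ih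
        have := hP k
        rw [hp] at this
        obtain ⟨q, hq, -⟩ := hWs k _ _ _ this
        exact ⟨q, hq⟩
    choose p hp using hmain
    have hstep : ∀ k, (r (k + 1)).1 (p (k + 1)) ≤ (r k).1 (p k) ∧
        (b k = true → (r (k + 1)).1 (p (k + 1)) < (r k).1 (p k)) := by
      intro k
      have := hP k
      rw [hp, hp] at this
      obtain ⟨q, hq, hh⟩ := hWs k _ _ _ this
      cases hq
      exact hh
    have hanti : Antitone fun k => (r k).1 (p k) := antitone_nat_of_succ_le fun k => (hstep k).1
    have hdec : ∀ c K, (r K).1 (p K) = c → False := by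
      intro c
      induction c using Nat.strong_induction_on with
      | _ c ih =>
        intro K hK
        obtain ⟨k, hk, hbk⟩ := hb K
        have h1 := (hstep k).2 hbk
        have h2 : (r k).1 (p k) ≤ (r K).1 (p K) := hanti hk
        exact ih _ (by omega) (k + 1) rfl
    exact hdec _ 0 rfl
  have hacc : α ∈ C.Lang := by rw [hC]; exact hrej
  rw [concat_mem _ W hW0 α hα] at hacc
  obtain ⟨t, b, ht0, htP, htb⟩ := hacc
  have hex : ∀ g : {g : Fin N → ℕ // QR m g}, ∃ s : T, ∀ K, ∃ k, K ≤ k ∧ r k = g ∧ t k = s := by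
    intro g
    by_contra hcon
    push Not at hcon
    choose K hK using hcon
    obtain ⟨k, hk, hkg⟩ := hr g (Finset.univ.sup K)
    exact hK (t k) k ((Finset.le_sup (Finset.mem_univ _)).trans hk) hkg rfl
  choose Φ hΦ using hex
  have key : ∀ f g : {g : Fin N → ℕ // QR m g}, Φ f = Φ g → ∀ z, ¬ f.1 z < g.1 z := by
    intro f g hfg z hz
    obtain ⟨j, hj0, hjg, hjt⟩ := hΦ g 1
    obtain ⟨k0, hk0, hbk0⟩ := htb j
    obtain ⟨i, hi0, hif, hit⟩ := hΦ f (k0 + 2)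
    have hji : j < i := by omega
    obtain ⟨β, hβ⟩ := exists_concat (fun k => W (lp j i k)) (fun k => hW0 _)
    have hβC : β ∈ C.Lang := by
      rw [concat_mem _ _ (fun k => hW0 _) β hβ]
      refine ⟨fun k => t (lp j i k), fun k => b (lp j i k), ht0, ?_, ?_⟩
      · intro k
        have h1 := htP (lp j i k)
        simp only [lp]
        split_ifs with hk
        · rw [hk, hit, hfg, ← hjt] at h1
          exact h1
        · exact h1
      · intro K
        obtain ⟨k, hk, hk2⟩ := lp_inf hji k0 hk0 (by omega) K
        exact ⟨k, hk, by simp only [hk2, hbk0]⟩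
    rw [hC] at hβC
    refine hβC ?_
    rw [concat_mem _ _ (fun k => hW0 _) β hβ]
    obtain ⟨c, hc1, hc2⟩ := exists_odd_between (g.2.1 z) (Or.inl hz)
    have hcm := c.2
    have htop : ∀ k, ∃ a, (r k).1 a = 2 * m - 1 := fun k =>
      (r k).2.2 _ (by omega) ⟨m - 1, by omega⟩
    have hmid : ∀ k, ∃ a, (r k).1 a = 2 * c.1 + 1 := fun k =>
      (r k).2.2 _ (by omega) ⟨c, rfl⟩
    choose u hu using htop
    choose v hv using hmid
    -- states and step facts
    let s : ℕ → Fin N := fun k => if k < j then u k else if k = j then z else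
      if k < i then v k else z
    have hsj : s j = z := by simp [s]
    have hsi : s i = z := by simp [s, show ¬ i < j by omega]
    have hrank1 : ∀ k, k < j → (r k).1 (s k) = 2 * m - 1 := by
      intro k hk; simp [s, hk, hu]
    have hrankj : (r j).1 (s j) = g.1 z := by rw [hsj, hjg]
    have hrank2 : ∀ k, j < k → k < i → (r k).1 (s k) = 2 * c.1 + 1 := by
      intro k hk hk2
      simp [s, show ¬ k < j by omega, show k ≠ j by omega, hk2, hv]
    have hranki : (r i).1 (s i) = f.1 z := by rw [hsi, hif]
    have hgz := g.2.1 z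
    have hstep : ∀ k, k < i → (r (k + 1)).1 (s (k + 1)) < (r k).1 (s k) ∨
        ((r (k + 1)).1 (s (k + 1)) = (r k).1 (s k) ∧ Odd ((r k).1 (s k))) := by
      intro k hk
      have hodd : ∀ a b : ℕ, b ≤ a → Odd a → b < a ∨ (b = a ∧ Odd a) := by
        intro a b hab ho
        rcases hab.lt_or_eq with h | h
        · exact Or.inl h
        · exact Or.inr ⟨h, ho⟩
      rcases lt_trichotomy k j with hkj | rfl | hkj
      · rw [hrank1 k hkj]
        apply hodd _ _ _ ⟨m - 1, by omega⟩
        have := (r (k + 1)).2.1 (s (k + 1))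
        omega
      · rw [hrankj, hrank2 (k + 1) (by omega) (by omega)]
        rcases hc2.lt_or_eq with h | h
        · exact Or.inl h
        · exact Or.inr ⟨h, h ▸ ⟨c, rfl⟩⟩
      · rw [hrank2 k hkj hk]
        apply hodd _ _ _ ⟨c, rfl⟩
        rcases Nat.lt_or_ge (k + 1) i with h | h
        · rw [hrank2 _ (by omega) h]
        · have : k + 1 = i := by omega
          rw [this, hranki]; exact hc1
    have hpath : ∀ k, k < i → Pth (Bt σ τ x y) (some (s k)) (W k) (some (s (k + 1)))
        (decide ((r (k + 1)).1 (s (k + 1)) < (r k).1 (s k))) := by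
      intro k hk
      rcases hstep k hk with h | ⟨h, ho⟩
      · rw [decide_eq_true h]; exact hWt k _ _ h
      · rw [decide_eq_false (by omega)]; exact hWf k _ _ h ho
    have hvis : ∃ k, j ≤ k ∧ k < i ∧ (r (k + 1)).1 (s (k + 1)) < (r k).1 (s k) := by
      rcases hc2.lt_or_eq with h | h
      · refine ⟨j, le_rfl, hji, ?_⟩
        rw [hrankj, hrank2 (j + 1) (by omega) (by omega)]
        exact h
      · refine ⟨i - 1, by omega, by omega, ?_⟩
        rw [Nat.sub_add_cancel (by omega), hranki, hrank2 (i - 1) (by omega) (by omega)]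
        omega
    refine ⟨fun k => some (s (lp j i k)), fun k => decide ((r (lp j i k + 1)).1
      (s (lp j i k + 1)) < (r (lp j i k)).1 (s (lp j i k))), by simp [Bt], ?_, ?_⟩
    · intro k
      have h1 := hpath (lp j i k) (lp_lt hji k)
      have h2 : s (lp j i (k + 1)) = s (lp j i k + 1) := by
        simp only [lp]
        split_ifs with hk
        · rw [hk, hsi, hsj]
        · rfl
      simp only [h2]
      exact h1
    · intro K
      obtain ⟨k1, hk1, hk2, hk3⟩ := hvis
      obtain ⟨k, hk, hke⟩ := lp_inf hji k1 hk1 hk2 K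
      exact ⟨k, hk, by simp only [hke]; exact decide_eq_true hk3⟩
  have hinj : Function.Injective Φ := by
    intro f g hfg
    apply Subtype.ext
    funext z
    have h1 := key f g hfg z
    have h2 := key g f hfg.symm z
    omega
  rw [← Nat.card_eq_fintype_card]
  exact Nat.card_le_card_of_injective Φ hinj

end Main

/-- for every `n > 1` there is an NBW with `n` states over an alphabet of at
most 7 letters whose complementation requires at least `L(n)` states. -/
theorem buchi_complementation_lower_bound_seven_letters (n : ℕ) (hn : 1 < n) :
    ∃ B : NBW (Fin 7) (FBState n),
      ∀ (T : Type) [Fintype T] (C : NBW (Fin 7) T),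
        C.Lang = B.Langᶜ → Lmax n ≤ Fintype.card T := by
  obtain ⟨σ, τ, x, y, h⟩ := exists_gen (N := n - 1) (by omega)
  refine ⟨Bt σ τ x y, fun T _ C hC => ?_⟩
  refine Finset.sup_le fun m hm => ?_
  exact main_bound h (Finset.mem_Ico.1 hm).1 T C hC

end YanPaper
end

section
/- For every n > 1, every deterministic complete Muller word automaton accepting L(FB_n) has at least L(n) states. -/
namespace YanPaper

section Walks
variable {T R : Type*} (step : T × R × R → T)

def esrc (e : T × R × R) : T × R := (e.1, e.2.1)
def etgt (e : T × R × R) : T × R := (step e, e.2.2)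

def Walk : T × R → List (T × R × R) → T × R → Prop
  | a, [], b => a = b
  | a, e :: l, b => esrc e = a ∧ Walk (etgt step e) l b

theorem walk_append {a b c : T × R} {l l' : List (T × R × R)} (h : Walk step a l b)
    (h' : Walk step b l' c) : Walk step a (l ++ l') c := by
  induction l generalizing a with
  | nil => simp only [Walk] at h; subst h; simpa using h'
  | cons e l ih => exact ⟨h.1, ih h.2⟩

theorem walk_zero {a b : T × R} {l : List (T × R × R)} (h : Walk step a l b)
    (h0 : 0 < l.length) : esrc l[0] = a := by
  cases l with
  | nil => simp at h0
  | cons e l => exact h.1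

theorem walk_succ {a b : T × R} {l : List (T × R × R)} (h : Walk step a l b) (i : ℕ)
    (h0 : i + 1 < l.length) : esrc l[i+1] = etgt step l[i] := by
  induction l generalizing a i with
  | nil => simp at h0
  | cons e l ih =>
    cases i with
    | zero => simpa using walk_zero step h.2 (by simpa using h0)
    | succ i => simpa using ih h.2 i (by simpa using h0)

theorem walk_last {a b : T × R} {l : List (T × R × R)} (h : Walk step a l b) (i : ℕ)
    (h0 : i + 1 = l.length) : etgt step (l[i]'(by omega)) = b := by
  induction l generalizing a i with
  | nil => simp at h0
  | cons e l ih =>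
    cases i with
    | zero =>
      cases l with
      | nil => exact h.2
      | cons e' l => simp at h0
    | succ i => simpa using ih h.2 i (by simpa using h0)

def VReach (a b : T × R) : Prop := ∃ l, Walk step a l b

theorem vreach_trans {a b c : T × R} (h : VReach step a b) (h' : VReach step b c) :
    VReach step a c := by
  obtain ⟨l, h⟩ := h; obtain ⟨l', h'⟩ := h'; exact ⟨_, walk_append step h h'⟩

theorem vreach_edge (e : T × R × R) : VReach step (esrc e) (etgt step e) := ⟨[e], rfl, rfl⟩

theorem exists_bottom [Finite T] [Finite R] (a : T × R) :
    ∃ v, VReach step a v ∧ ∀ w, VReach step v w → VReach step w v := by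
  obtain ⟨v, hv⟩ := Set.Finite.exists_minimalFor (fun v => {w | VReach step v w})
    {v | VReach step a v} (Set.toFinite _) ⟨a, [], rfl⟩
  refine ⟨v, hv.1, fun w hw => ?_⟩
  have h1 := hv.2 (show w ∈ {v | VReach step a v} from vreach_trans step hv.1 hw)
    (fun x hx => vreach_trans step hw hx)
  exact h1 (show VReach step v v from ⟨[], rfl⟩)

theorem walk_mem {v a b : T × R} {l : List (T × R × R)} (h : Walk step a l b)
    (hv : VReach step v a) : ∀ e ∈ l, VReach step v (esrc e) := by
  induction l generalizing a with
  | nil => simp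
  | cons e l ih =>
    intro e' he'
    rcases List.mem_cons.1 he' with rfl | he'
    · rw [h.1]; exact hv
    · refine ih h.2 (vreach_trans step hv ?_) e' he'
      rw [← h.1]; exact vreach_edge step e

theorem cover {v : T × R} (hv : ∀ w, VReach step v w → VReach step w v)
    {a b : T × R} (ha : VReach step v a) (hb : VReach step v b)
    (s : Finset (T × R × R)) (hs : ∀ e ∈ s, VReach step v (esrc e)) :
    ∃ l, Walk step a l b ∧ ∀ e ∈ s, e ∈ l := by
  classical
  induction s using Finset.induction_on with
  | empty =>
    obtain ⟨l, hl⟩ := vreach_trans step (hv a ha) hb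
    exact ⟨l, hl, by simp⟩
  | insert e s he ih =>
    obtain ⟨l, hl, hc⟩ := ih (fun e' he' => hs e' (Finset.mem_insert_of_mem he'))
    have he1 := hs e (Finset.mem_insert_self _ _)
    obtain ⟨l1, h1⟩ := vreach_trans step (hv b hb) he1
    have he2 : VReach step v (etgt step e) := vreach_trans step he1 (vreach_edge step e)
    obtain ⟨l2, h2⟩ := vreach_trans step (hv _ he2) hb
    refine ⟨l ++ (l1 ++ (e :: l2)), walk_append step hl (walk_append step h1 ⟨rfl, h2⟩), ?_⟩
    intro e' he'
    rcases Finset.mem_insert.1 he' with rfl | h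
    · simp
    · simp [hc e' h]

theorem exists_seq [Finite T] [Finite R] {v : T × R} (q0 : T) (f0 : R)
    (hv0 : VReach step (q0, f0) v)
    (hv : ∀ w, VReach step v w → VReach step w v) (q : T) (f g : R)
    (hg : VReach step v (q, g)) (hf : VReach step v (q, f)) :
    ∃ (e : ℕ → T × R × R) (P N : ℕ), 0 < N ∧ (e 0).1 = q0 ∧
      (∀ i, (e (i+1)).1 = step (e i)) ∧
      (∀ i, ¬ (P ≤ i ∧ (i + 1 - P) % N = 0) → (e (i+1)).2.1 = (e i).2.2) ∧
      (∀ i, P ≤ i → (i - P) % N = 0 → (e i).2.1 = g) ∧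
      (∀ i, P ≤ i → (i + 1 - P) % N = 0 → (e i).2.2 = f) ∧
      (∀ i, P ≤ i → VReach step v (esrc (e i))) ∧
      (∀ x, VReach step v (esrc x) → ∀ k, ∃ i, k ≤ i ∧ e i = x) := by
  classical
  obtain ⟨l0, h0⟩ := vreach_trans step hv0 hg
  have := Fintype.ofFinite T
  have := Fintype.ofFinite R
  obtain ⟨l, hl, hc⟩ := cover step hv hg hf
    (Finset.univ.filter fun e => VReach step v (esrc e)) (by simp)
  have hc' : ∀ e, VReach step v (esrc e) → e ∈ l := fun e he => hc e (by simp [he])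
  have hpos : 0 < l.length := List.length_pos_of_mem (hc' (q, g, g) hg)
  have hmod : ∀ i, i % l.length < l.length := fun i => Nat.mod_lt _ hpos
  let e : ℕ → T × R × R := fun i => if h : i < l0.length then l0[i] else
    l[(i - l0.length) % l.length]'(hmod _)
  have e1 : ∀ i (h : i < l0.length), e i = l0[i] := fun i h => by simp [e, h]
  have e2 : ∀ i, l0.length ≤ i → e i = l[(i - l0.length) % l.length]'(hmod _) :=
    fun i h => by simp [e, not_lt.2 h]
  have e2' : ∀ i j (h : j < l.length), l0.length ≤ i → (i - l0.length) % l.length = j →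
    e i = l[j] := by
    intro i j h h1 h2; subst h2; exact e2 i h1
  have wrap : ∀ i, l0.length ≤ i → (i + 1 - l0.length) % l.length = 0 →
      (i - l0.length) % l.length + 1 = l.length := by
    intro i hi h
    have h3 : i + 1 - l0.length = (i - l0.length) + 1 := by omega
    rw [h3] at h
    have h4 := hmod (i - l0.length)
    rw [Nat.add_mod_eq_ite] at h
    by_contra h5
    by_cases h6 : l.length = 1
    · omega
    · have : 1 % l.length = 1 := Nat.mod_eq_of_lt (by omega)
      rw [this] at h
      split_ifs at h <;> omega
  have nwrap : ∀ i, l0.length ≤ i → (i + 1 - l0.length) % l.length ≠ 0 →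
      (i - l0.length) % l.length + 1 < l.length ∧
      (i + 1 - l0.length) % l.length = (i - l0.length) % l.length + 1 := by
    intro i hi h
    have h3 : i + 1 - l0.length = (i - l0.length) + 1 := by omega
    rw [h3] at h ⊢
    have h4 := hmod (i - l0.length)
    have h6 : (i - l0.length) % l.length + 1 ≠ l.length := by
      intro h7
      apply h
      rw [← Nat.mod_add_mod, h7, Nat.mod_self]
    refine ⟨by omega, ?_⟩
    rw [← Nat.mod_add_mod, Nat.mod_eq_of_lt (by omega)]
  have s0 : ∀ i, l0.length ≤ i → (i - l0.length) % l.length = 0 → esrc (e i) = (q, g) := by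
    intro i hi h
    rw [e2' i 0 hpos hi h]; exact walk_zero step hl hpos
  have t0 : ∀ i, l0.length ≤ i → (i + 1 - l0.length) % l.length = 0 →
      etgt step (e i) = (q, f) := by
    intro i hi h
    rw [e2 i hi]; exact walk_last step hl _ (wrap i hi h)
  have link : ∀ i, ¬ (l0.length ≤ i ∧ (i + 1 - l0.length) % l.length = 0) →
      esrc (e (i+1)) = etgt step (e i) := by
    intro i hi
    by_cases h1 : i + 1 < l0.length
    · rw [e1 _ h1, e1 i (by omega)]; exact walk_succ step h0 i h1
    by_cases h2 : i + 1 = l0.length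
    · rw [s0 (i+1) (by omega) (by simp [h2]), e1 i (by omega)]
      exact (walk_last step h0 i h2).symm
    · have h3 : l0.length ≤ i := by omega
      obtain ⟨h4, h5⟩ := nwrap i h3 (fun h => hi ⟨h3, h⟩)
      rw [e2' (i+1) _ h4 (by omega) h5, e2 i h3]
      exact walk_succ step hl _ h4
  refine ⟨e, l0.length, l.length, hpos, ?_, ?_, ?_, ?_, ?_, ?_, ?_⟩
  · by_cases h : 0 < l0.length
    · rw [e1 0 h]; exact congrArg Prod.fst (walk_zero step h0 h)
    · have hnil : l0 = [] := by simpa using h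
      have := congrArg Prod.fst (s0 0 (by omega) (by simp))
      rw [hnil] at h0
      simp only [Walk, Prod.mk.injEq] at h0
      simp only [esrc] at this
      rw [this, h0.1]
  · intro i
    by_cases h : l0.length ≤ i ∧ (i + 1 - l0.length) % l.length = 0
    · have h1 := congrArg Prod.fst (s0 (i+1) (by omega) h.2)
      have h2 := congrArg Prod.fst (t0 i h.1 h.2)
      simp only [esrc, etgt] at h1 h2
      rw [h1, h2]
    · exact congrArg Prod.fst (link i h)
  · intro i h
    exact congrArg Prod.snd (link i h)
  · intro i hi h; exact congrArg Prod.snd (s0 i hi h)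
  · intro i hi h; exact congrArg Prod.snd (t0 i hi h)
  · intro i hi
    rw [e2 i hi]
    exact walk_mem step hl hg _ (List.getElem_mem _)
  · intro x hx k
    obtain ⟨j, hj, rfl⟩ := List.getElem_of_mem (hc' x hx)
    refine ⟨l0.length + (j + l.length * k), ?_, ?_⟩
    · nlinarith
    · apply e2' _ _ _ (by omega)
      rw [Nat.add_sub_cancel_left, Nat.add_mul_mod_self_left, Nat.mod_eq_of_lt hj]

end Walks

section Blocks
variable {n : ℕ}

/-- letters of the self-segment -/
def ELet (f : Fin (n-1) → ℕ) (j : ℕ) : FBAlpha n :=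
  {x | (∃ p, x = (some p, some p)) ∨ (j % 2 = 0 ∧ ∃ p, f p = j / 2 ∧ x = (some p, none)) ∨
    (j % 2 = 1 ∧ ∃ q, f q < j / 2 ∧ x = (none, some q))}

def CLet (f g : Fin (n-1) → ℕ) : FBAlpha n :=
  {x | ∃ p q, f p = g q ∧ Odd (f p) ∧ x = (some p, some q)}

def BLet (m : ℕ) (f g : Fin (n-1) → ℕ) (j : ℕ) : FBAlpha n :=
  if j < 4 * m then ELet f j else if j = 4 * m then CLet f g else ELet g (j - (4 * m + 1))

theorem epath (m : ℕ) (f : Fin (n-1) → ℕ) (p q : Fin (n-1)) (hp : f p < 2 * m)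
    (h : f q < f p ∨ p = q) : ∃ ρ : ℕ → FBState n, ρ 0 = some p ∧ ρ (4 * m) = some q ∧
      (∀ j < 4 * m, (ρ j, ρ (j+1)) ∈ ELet f j) ∧ (f q < f p → ∃ j < 4 * m, ρ j = none) := by
  by_cases h1 : f q < f p
  · refine ⟨fun j => if j ≤ 2 * f p then some p else if j = 2 * f p + 1 then none else some q,
      by simp, ?_, ?_, fun _ => ⟨2 * f p + 1, by omega, by simp⟩⟩
    · have h2 : ¬ (4 * m ≤ 2 * f p) := by omega
      have h3 : ¬ (4 * m = 2 * f p + 1) := by omega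
      simp only [h2, h3, if_false]
    · intro j hj
      rcases lt_trichotomy j (2 * f p) with h2 | h2 | h2
      · left
        exact ⟨p, by simp [h2.le, Nat.succ_le_of_lt h2]⟩
      · right; left
        refine ⟨by omega, p, by omega, by simp [h2]⟩
      · by_cases h3 : j = 2 * f p + 1
        · right; right
          exact ⟨by omega, q, by omega, by simp [h3]⟩
        · left
          refine ⟨q, ?_⟩
          have a1 : ¬ j ≤ 2 * f p := by omega
          have a2 : ¬ j + 1 ≤ 2 * f p := by omega
          have a3 : ¬ j + 1 = 2 * f p + 1 := by omega
          simp only [a1, a2, a3, h3, if_false]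
  · have : p = q := by tauto
    subst this
    exact ⟨fun _ => some p, rfl, rfl, fun j _ => Or.inl ⟨p, rfl⟩, fun h => absurd h h1⟩

theorem bpath (m : ℕ) (f g : Fin (n-1) → ℕ) (hf : QRanking n m f) (hg : QRanking n m g)
    (p q : Fin (n-1)) (h : g q < f p ∨ (f p = g q ∧ Odd (f p))) :
    ∃ ρ : ℕ → FBState n, ρ 0 = some p ∧ ρ (8 * m + 1) = some q ∧
      (∀ j < 8 * m + 1, (ρ j, ρ (j+1)) ∈ BLet m f g j) ∧
      (g q < f p → ∃ j < 8 * m + 1, ρ j = none) := by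
  have key : ∃ x y, (f x < f p ∨ p = x) ∧ f x = g y ∧ Odd (f x) ∧ (g q < g y ∨ y = q) ∧
      (g q < f p → f x < f p ∨ g q < g y) := by
    rcases Nat.even_or_odd (f p) with he | ho
    · have hlt : g q < f p := by
        rcases h with h | h
        · exact h
        · exact absurd h.2 (Nat.not_odd_iff_even.2 he)
      have hp := hf.1 p
      have hodd : Odd (f p - 1) := by
        obtain ⟨k, hk⟩ := he; exact ⟨k - 1, by omega⟩
      obtain ⟨x, hx⟩ := hf.2 (f p - 1) (by omega) hodd
      by_cases hq : g q = f p - 1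
      · exact ⟨x, q, by omega, by omega, by rwa [hx], Or.inr rfl, fun _ => by omega⟩
      · obtain ⟨y, hy⟩ := hg.2 (f p - 1) (by omega) hodd
        exact ⟨x, y, by omega, by omega, by rwa [hx], by omega, fun _ => by omega⟩
    · rcases h with h | h
      · obtain ⟨y, hy⟩ := hg.2 (f p) (hf.1 p) ho
        exact ⟨p, y, Or.inr rfl, hy.symm, ho, by omega, by omega⟩
      · exact ⟨p, q, Or.inr rfl, h.1, ho, Or.inr rfl, by omega⟩
  obtain ⟨x, y, h1, h2, h3, h4, h5⟩ := key
  obtain ⟨ρ, r0, r1, r2, r3⟩ := epath m f p x (hf.1 p) (h1)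
  obtain ⟨σ, s0, s1, s2, s3⟩ := epath m g y q (hg.1 y) (h4)
  refine ⟨fun j => if j ≤ 4 * m then ρ j else σ (j - (4 * m + 1)), by simpa using r0, ?_, ?_, ?_⟩
  · have a1 : ¬ 8 * m + 1 ≤ 4 * m := by omega
    have a2 : 8 * m + 1 - (4 * m + 1) = 4 * m := by omega
    simp only [a1, if_false, a2, s1]
  · intro j hj
    rcases lt_trichotomy j (4 * m) with h | h | h
    · have a1 : j + 1 ≤ 4 * m := h
      simp only [BLet, h, h.le, a1, if_true]; exact r2 j h
    · subst h
      simp only [BLet, lt_irrefl, if_false, if_true, le_refl]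
      have a1 : ¬ 4 * m + 1 ≤ 4 * m := by omega
      simp only [a1, if_false, Nat.sub_self, r1, s0]
      exact ⟨x, y, h2, h3, rfl⟩
    · have a1 : ¬ j ≤ 4 * m := by omega
      have a2 : ¬ j + 1 ≤ 4 * m := by omega
      have a3 : ¬ j < 4 * m := by omega
      have a4 : ¬ j = 4 * m := by omega
      have a5 : j + 1 - (4 * m + 1) = j - (4 * m + 1) + 1 := by omega
      simp only [BLet, a1, a2, a3, a4, a5, if_false]
      exact s2 _ (by omega)
  · intro hlt
    rcases h5 hlt with h | h
    · obtain ⟨j, hj, hj'⟩ := r3 h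
      exact ⟨j, by omega, by simp [hj.le, hj']⟩
    · obtain ⟨j, hj, hj'⟩ := s3 h
      refine ⟨4 * m + 1 + j, by omega, ?_⟩
      have a1 : ¬ 4 * m + 1 + j ≤ 4 * m := by omega
      simp only [a1, if_false, Nat.add_sub_cancel_left, hj']

/-- potential -/
def EPot (f : Fin (n-1) → ℕ) (j : ℕ) : FBState n → ℕ
  | some p => 2 * f p + 1
  | none => 2 * (j / 2)

theorem epot (f : Fin (n-1) → ℕ) (j : ℕ) (x y : FBState n) (h : (x, y) ∈ ELet f j) :
    EPot f (j+1) y ≤ EPot f j x ∧ (y = none → EPot f (j+1) y < EPot f j x) := by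
  rcases h with ⟨p, h⟩ | ⟨hj, p, hp, h⟩ | ⟨hj, p, hp, h⟩ <;>
    simp only [Prod.mk.injEq] at h <;> obtain ⟨rfl, rfl⟩ := h <;> simp [EPot] <;> omega

def BPot (m : ℕ) (f g : Fin (n-1) → ℕ) (j : ℕ) : FBState n → ℕ :=
  if j ≤ 4 * m then EPot f j else EPot g (j - (4 * m + 1))

theorem bpot (m : ℕ) (f g : Fin (n-1) → ℕ) (j : ℕ) (x y : FBState n)
    (h : (x, y) ∈ BLet m f g j) :
    BPot m f g (j+1) y ≤ BPot m f g j x ∧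
      (y = none → BPot m f g (j+1) y < BPot m f g j x) := by
  rcases lt_trichotomy j (4 * m) with h1 | h1 | h1
  · have a1 : j + 1 ≤ 4 * m := h1
    simp only [BLet, BPot, h1, h1.le, a1, if_true] at h ⊢
    exact epot f j x y h
  · subst h1
    have a1 : ¬ 4 * m + 1 ≤ 4 * m := by omega
    simp only [BLet, BPot, lt_irrefl, if_false, if_true, le_refl, a1] at h ⊢
    obtain ⟨p, q, h2, h3, h4⟩ := h
    simp only [Prod.mk.injEq] at h4
    obtain ⟨rfl, rfl⟩ := h4
    simp [EPot, h2]
  · have a1 : ¬ j ≤ 4 * m := by omega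
    have a2 : ¬ j + 1 ≤ 4 * m := by omega
    have a3 : ¬ j < 4 * m := by omega
    have a4 : ¬ j = 4 * m := by omega
    have a5 : j + 1 - (4 * m + 1) = j - (4 * m + 1) + 1 := by omega
    simp only [BLet, BPot, a1, a2, a3, a4, a5, if_false] at h ⊢
    exact epot g _ x y h

/-- The infinite word. -/
def bword (m : ℕ) (F G : ℕ → Fin (n-1) → ℕ) (t : ℕ) : FBAlpha n :=
  BLet m (F (t / (8 * m + 1))) (G (t / (8 * m + 1))) (t % (8 * m + 1))

theorem succ_cases (K t : ℕ) (hK : 0 < K) :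
    ((t + 1) / K = t / K ∧ (t + 1) % K = t % K + 1) ∨
    ((t + 1) / K = t / K + 1 ∧ (t + 1) % K = 0 ∧ t % K + 1 = K) := by
  have h1 := Nat.mod_lt t hK
  have h2 := Nat.div_add_mod t K
  rcases Nat.lt_or_ge (t % K + 1) K with h | h
  · left
    have : t + 1 = (t % K + 1) + K * (t / K) := by omega
    constructor
    · conv_lhs => rw [this]
      rw [Nat.add_mul_div_left _ _ hK, Nat.div_eq_of_lt h, zero_add]
    · conv_lhs => rw [this]
      rw [Nat.add_mul_mod_self_left, Nat.mod_eq_of_lt h]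
  · right
    have h3 : t % K + 1 = K := by omega
    have : t + 1 = K * (t / K + 1) := by rw [Nat.mul_add, mul_one]; omega
    refine ⟨?_, ?_, h3⟩
    · rw [this, Nat.mul_div_cancel_left _ hK]
    · rw [this, Nat.mul_mod_right]

theorem not_mem_lang (m : ℕ) (hm : 0 < m) (F G : ℕ → Fin (n-1) → ℕ)
    (h : ∀ i, F (i+1) = G i) : bword m F G ∉ (FB n).Lang := by
  rintro ⟨ρ, -, hr, s, hs, hsF⟩
  have hsF : s = none := hsF
  subst hsF
  let φ : ℕ → ℕ := fun t => BPot m (F (t / (8 * m + 1))) (G (t / (8 * m + 1))) (t % (8 * m + 1)) (ρ t)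
  have hstep : ∀ t, φ (t+1) ≤ φ t ∧ (ρ (t+1) = none → φ (t+1) < φ t) := by
    intro t
    have hb := bpot m _ _ _ _ _ (hr t)
    rcases succ_cases (8 * m + 1) t (by omega) with ⟨h1, h2⟩ | ⟨h1, h2, h3⟩
    · simp only [φ, h1, h2]; exact hb
    · have hne : ρ (t+1) ≠ none := by
        intro hn
        have h4 := hr t
        simp only [bword, FB] at h4
        rw [hn] at h4
        have a3 : ¬ t % (8 * m + 1) < 4 * m := by omega
        have a4 : ¬ t % (8 * m + 1) = 4 * m := by omega
        simp only [BLet, a3, a4, if_false] at h4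
        rcases h4 with ⟨p, h⟩ | ⟨hj, p, hp, h⟩ | ⟨hj, p, hp, h⟩
        · simp at h
        · omega
        · simp at h
      refine ⟨?_, fun hn => absurd hn hne⟩
      refine le_trans (le_of_eq ?_) hb.1
      obtain ⟨p, hp⟩ := Option.ne_none_iff_exists'.1 hne
      have a1 : ¬ t % (8 * m + 1) + 1 ≤ 4 * m := by omega
      simp only [φ, h1, h2, BPot, a1, hp, EPot, h, if_false, zero_le, if_true]
  have hanti : Antitone φ := antitone_nat_of_succ_le fun t => (hstep t).1
  have hbound : ∀ k, ∃ t, φ t + k ≤ φ 0 := by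
    intro k
    induction k with
    | zero => exact ⟨0, by simp⟩
    | succ k ih =>
      obtain ⟨t, ht⟩ := ih
      obtain ⟨t', ht', hn⟩ := hs (t+1)
      obtain ⟨u, rfl⟩ : ∃ u, t' = u + 1 := ⟨t' - 1, by omega⟩
      have h1 := (hstep u).2 hn
      have h2 := hanti (show t ≤ u by omega)
      exact ⟨u + 1, by omega⟩
  obtain ⟨t, ht⟩ := hbound (φ 0 + 1)
  omega

theorem mem_lang_of (m : ℕ) (F G : ℕ → Fin (n-1) → ℕ)
    (hF : ∀ i, QRanking n m (F i)) (hG : ∀ i, QRanking n m (G i))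
    (s : ℕ → Fin (n-1))
    (hs : ∀ i, G i (s (i+1)) < F i (s i) ∨ (F i (s i) = G i (s (i+1)) ∧ Odd (F i (s i))))
    (hv : ∀ k, ∃ i, k ≤ i ∧ G i (s (i+1)) < F i (s i)) : bword m F G ∈ (FB n).Lang := by
  choose π p0 p1 p2 p3 using fun i => bpath m (F i) (G i) (hF i) (hG i) (s i) (s (i+1)) (hs i)
  have hK : 0 < 8 * m + 1 := by omega
  refine ⟨fun t => π (t / (8 * m + 1)) (t % (8 * m + 1)), ?_, ?_, none, ?_, rfl⟩
  · simp [FB, p0]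
  · intro t
    have h1 := p2 (t / (8 * m + 1)) (t % (8 * m + 1)) (Nat.mod_lt _ hK)
    show (π (t / (8 * m + 1)) (t % (8 * m + 1)),
      π ((t + 1) / (8 * m + 1)) ((t + 1) % (8 * m + 1))) ∈ BLet m _ _ _
    rcases succ_cases (8 * m + 1) t hK with ⟨h2, h3⟩ | ⟨h2, h3, h4⟩
    · rw [h2, h3]; exact h1
    · rw [h2, h3, p0, ← p1]
      rw [h4] at h1
      exact h1
  · intro k
    obtain ⟨i, hi, hlt⟩ := hv k
    obtain ⟨j, hj, hj'⟩ := p3 i hlt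
    refine ⟨j + (8 * m + 1) * i, by nlinarith, ?_⟩
    show π _ _ = none
    rw [Nat.add_mul_div_left _ _ hK, Nat.div_eq_of_lt hj, zero_add, Nat.add_mul_mod_self_left,
      Nat.mod_eq_of_lt hj, hj']

theorem mem_lang_jump (m : ℕ) (hm : 0 < m) (F G : ℕ → Fin (n-1) → ℕ)
    (hF : ∀ i, QRanking n m (F i)) (hG : ∀ i, QRanking n m (G i))
    (P N : ℕ) (hN : 0 < N) (f g : Fin (n-1) → ℕ) (p : Fin (n-1)) (hp : f p < g p)
    (h1 : ∀ i, ¬ (P ≤ i ∧ (i + 1 - P) % N = 0) → F (i+1) = G i)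
    (h2 : ∀ i, P ≤ i → (i - P) % N = 0 → F i = g)
    (h3 : ∀ i, P ≤ i → (i + 1 - P) % N = 0 → G i = f) : bword m F G ∈ (FB n).Lang := by
  classical
  have hgm : g p < 2 * m := by
    have := h2 P le_rfl (by simp)
    rw [← this]; exact (hF P).1 p
  obtain ⟨d, hd, hd1, hd2, hd3⟩ : ∃ d, Odd d ∧ f p ≤ d ∧ d ≤ g p ∧ (d < g p ∨ d = g p) := by
    rcases Nat.even_or_odd (g p) with he | ho
    · refine ⟨g p - 1, ?_, by omega, by omega, by omega⟩
      obtain ⟨k, hk⟩ := he; exact ⟨k - 1, by omega⟩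
    · exact ⟨g p, ho, hp.le, le_rfl, Or.inr rfl⟩
  have hD : Odd (2 * m - 1) := ⟨m - 1, by omega⟩
  let D : ℕ → ℕ := fun i => if i < P then 2 * m - 1 else d
  have hDo : ∀ i, Odd (D i) := by intro i; simp only [D]; split_ifs <;> assumption
  have hDl : ∀ i, D i < 2 * m := by intro i; simp only [D]; split_ifs <;> omega
  choose rep hrep using fun i => (hF i).2 (D i) (hDl i) (hDo i)
  let s : ℕ → Fin (n-1) := fun i => if P ≤ i ∧ (i - P) % N = 0 then p else rep i
  have s1 : ∀ i, P ≤ i → (i - P) % N = 0 → s i = p := fun i a b => by simp [s, a, b]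
  have s2 : ∀ i, ¬ (P ≤ i ∧ (i - P) % N = 0) → s i = rep i := fun i a => by simp only [s, a, if_false]
  -- source rank
  have src1 : ∀ i, P ≤ i → (i - P) % N = 0 → F i (s i) = g p := fun i a b => by
    rw [s1 i a b, h2 i a b]
  have src2 : ∀ i, ¬ (P ≤ i ∧ (i - P) % N = 0) → F i (s i) = D i := fun i a => by
    rw [s2 i a, hrep]
  -- target rank
  have tgt1 : ∀ i, P ≤ i → (i + 1 - P) % N = 0 → G i (s (i+1)) = f p := fun i a b => by
    rw [s1 (i+1) (by omega) b, h3 i a b]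
  have tgt2 : ∀ i, ¬ (P ≤ i ∧ (i + 1 - P) % N = 0) → G i (s (i+1)) = F (i+1) (s (i+1)) :=
    fun i a => by rw [h1 i a]
  have D1 : ∀ i, i < P → D i = 2 * m - 1 := fun i h => by simp [D, h]
  have D2 : ∀ i, P ≤ i → D i = d := fun i h => by simp [D, not_lt.2 h]
  refine mem_lang_of m F G hF hG s ?_ ?_
  · intro i
    by_cases hi : P ≤ i
    · by_cases a : (i - P) % N = 0
      · rw [src1 i hi a]
        by_cases b : (i + 1 - P) % N = 0
        · rw [tgt1 i hi b]; exact Or.inl hp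
        · rw [tgt2 i (by tauto), src2 (i+1) (by tauto), D2 _ (by omega)]
          rcases hd3 with h | h
          · exact Or.inl h
          · right; rw [← h]; exact ⟨rfl, hd⟩
      · rw [src2 i (by tauto), D2 i hi]
        by_cases b : (i + 1 - P) % N = 0
        · rw [tgt1 i hi b]
          rcases hd1.lt_or_eq with h | h
          · exact Or.inl h
          · exact Or.inr ⟨h.symm, hd⟩
        · rw [tgt2 i (by tauto), src2 (i+1) (by tauto), D2 _ (by omega)]
          exact Or.inr ⟨rfl, hd⟩
    · rw [src2 i (by tauto), tgt2 i (by tauto), D1 i (by omega)]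
      have := (hF (i+1)).1 (s (i+1))
      rcases Nat.lt_or_ge (F (i+1) (s (i+1))) (2 * m - 1) with h | h
      · exact Or.inl h
      · exact Or.inr ⟨by omega, hD⟩
  · intro k
    rcases hd3 with h | h
    · refine ⟨P + N * k, by nlinarith, ?_⟩
      rw [src1 _ (by omega) (by simp)]
      by_cases b : (P + N * k + 1 - P) % N = 0
      · rw [tgt1 _ (by omega) b]; exact hp
      · rw [tgt2 _ (by tauto), src2 _ (by tauto), D2 _ (by omega)]; exact h
    · refine ⟨P + N * k + (N - 1), by nlinarith, ?_⟩
      have b : (P + N * k + (N - 1) + 1 - P) % N = 0 := by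
        have : P + N * k + (N - 1) + 1 - P = N * (k + 1) := by rw [Nat.mul_add, mul_one]; omega
        rw [this, Nat.mul_mod_right]
      rw [tgt1 _ (by omega) b]
      by_cases a : (P + N * k + (N - 1) - P) % N = 0
      · rw [src1 _ (by omega) a]; exact hp
      · rw [src2 _ (by tauto), D2 _ (by omega)]; omega

end Blocks

section Main
variable {n : ℕ} {T : Type}

/-- state of the deterministic automaton after `j` letters of a block. -/
def dst (m : ℕ) (δ : T → FBAlpha n → T)
    (e : T × {g : Fin (n - 1) → ℕ // QRanking n m g} × {g : Fin (n - 1) → ℕ // QRanking n m g}) :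
    ℕ → T
  | 0 => e.1
  | j + 1 => δ (dst m δ e j) (BLet m e.2.1.1 e.2.2.1 j)

theorem infOcc_eq {E : Type*} (K : ℕ) (hK : 0 < K) (d : E → ℕ → T) (C : Set E) (e : ℕ → E)
    (P : ℕ) (h1 : ∀ i, P ≤ i → e i ∈ C) (h2 : ∀ x ∈ C, ∀ k, ∃ i, k ≤ i ∧ e i = x) :
    InfOcc (fun t => d (e (t / K)) (t % K)) = {s | ∃ x ∈ C, ∃ j < K, d x j = s} := by
  ext s
  constructor
  · intro h
    obtain ⟨t, ht, hs⟩ := h (K * P)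
    exact ⟨e (t / K), h1 _ ((Nat.le_div_iff_mul_le hK).2 (by rw [mul_comm]; exact ht)),
      t % K, Nat.mod_lt _ hK, hs⟩
  · rintro ⟨x, hx, j, hj, rfl⟩ k
    obtain ⟨i, hi, rfl⟩ := h2 x hx k
    refine ⟨j + K * i, by nlinarith, ?_⟩
    show d _ _ = _
    rw [Nat.add_mul_div_left _ _ hK, Nat.div_eq_of_lt hj, zero_add, Nat.add_mul_mod_self_left,
      Nat.mod_eq_of_lt hj]

theorem Lnm_le_s12 (m : ℕ) (hm : 0 < m)
    [Fintype T] (M : NMW (FBAlpha n) T)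
    (hdet : ∃ q₀ : T, M.I = {q₀}) (hcomp : ∀ p a, ∃! q, M.Δ p a q)
    (hM : M.Lang = (FB n).Lang) : Lnm n m ≤ Fintype.card T := by
  classical
  by_contra hcon
  push Not at hcon
  obtain ⟨q0, hq0⟩ := hdet
  choose δ hδ hδu using hcomp
  simp only at hδ hδu
  unfold Lnm at hcon
  set R := {g : Fin (n - 1) → ℕ // QRanking n m g} with hR
  have hfin : Finite R := Nat.finite_of_card_ne_zero (by omega)
  have hRne : Nonempty R := (Nat.card_pos_iff.1 (by omega)).1
  obtain ⟨f0⟩ := hRne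
  let step : T × R × R → T := fun e => dst m δ e (8 * m + 1)
  obtain ⟨v, hv0, hv⟩ := exists_bottom step (q0, f0)
  have hpts : ∀ f : R, ∃ q, VReach step v (q, f) := fun f =>
    ⟨_, vreach_edge step (v.1, v.2, f)⟩
  choose Q hQ using hpts
  have hninj : ¬ Function.Injective Q := fun hi => by
    have := Nat.card_le_card_of_injective Q hi
    rw [Nat.card_eq_fintype_card (α := T)] at this
    omega
  -- choose a good pair
  obtain ⟨f, g, p, hfg, hp⟩ : ∃ f g : R, ∃ p, Q f = Q g ∧ f.1 p < g.1 p := by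
    simp only [Function.Injective, not_forall] at hninj
    obtain ⟨f, g, h1, h2⟩ := hninj
    have : f.1 ≠ g.1 := fun h => h2 (Subtype.ext h)
    obtain ⟨p, hp⟩ := Function.ne_iff.1 this
    rcases lt_or_gt_of_ne hp with h | h
    · exact ⟨f, g, p, h1, h⟩
    · exact ⟨g, f, p, h1.symm, h⟩
  set X : Set T := {s | ∃ x ∈ {x : T × R × R | VReach step v (esrc x)},
    ∃ j < 8 * m + 1, dst m δ x j = s} with hX
  have hK : 0 < 8 * m + 1 := by omega
  -- run of M
  have hrun : ∀ e : ℕ → T × R × R, (∀ i, (e (i+1)).1 = step (e i)) → ∀ t,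
      dst m δ (e ((t + 1) / (8 * m + 1))) ((t + 1) % (8 * m + 1)) =
      δ (dst m δ (e (t / (8 * m + 1))) (t % (8 * m + 1)))
        (bword m (fun i => (e i).2.1.1) (fun i => (e i).2.2.1) t) := by
    intro e he t
    rcases succ_cases (8 * m + 1) t hK with ⟨h2, h3⟩ | ⟨h2, h3, h4⟩
    · rw [h2, h3]; rfl
    · rw [h2, h3]
      show (e _).1 = dst m δ (e (t / (8 * m + 1))) (t % (8 * m + 1) + 1)
      rw [h4, he]
  -- legit
  have hXn : X ∉ M.Acc := by
    intro hacc
    obtain ⟨e, P, N, hN, a0, a1, a2, a3, a4, a5, a6⟩ :=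
      exists_seq step q0 f0 hv0 hv (Q g) g g (hQ g) (hQ g)
    have hnot := not_mem_lang m hm (fun i => (e i).2.1.1) (fun i => (e i).2.2.1) (by
      intro i
      by_cases h : P ≤ i ∧ (i + 1 - P) % N = 0
      · simp only [a3 (i+1) (by omega) h.2, a4 i h.1 h.2]
      · simp only [a2 i h])
    apply hnot
    rw [← hM]
    refine ⟨fun t => dst m δ (e (t / (8 * m + 1))) (t % (8 * m + 1)), ?_, ?_, ?_⟩
    · rw [hq0]; simp [dst, a0]
    · intro t
      simp only [hrun e a1 t]
      exact hδ _ _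
    · rw [infOcc_eq (8 * m + 1) hK (dst m δ) {x | VReach step v (esrc x)} e P a5 a6]
      exact hacc
  apply hXn
  obtain ⟨e, P, N, hN, a0, a1, a2, a3, a4, a5, a6⟩ :=
    exists_seq step q0 f0 hv0 hv (Q g) f g (hQ g) (hfg ▸ hQ f)
  have hmem := mem_lang_jump m hm (fun i => (e i).2.1.1) (fun i => (e i).2.2.1)
    (fun i => (e i).2.1.2) (fun i => (e i).2.2.2) P N hN f.1 g.1 p hp
    (fun i h => by simp only [a2 i h]) (fun i h h' => by simp only [a3 i h h'])
    (fun i h h' => by simp only [a4 i h h'])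
  rw [← hM] at hmem
  obtain ⟨ρ, r0, r1, r2⟩ := hmem
  have hρ : ρ = fun t => dst m δ (e (t / (8 * m + 1))) (t % (8 * m + 1)) := by
    funext t
    induction t with
    | zero =>
      rw [hq0] at r0
      simpa [dst, a0] using r0
    | succ t ih =>
      rw [hrun e a1 t, ← ih]
      exact hδu _ _ _ (r1 t)
  rw [hρ, infOcc_eq (8 * m + 1) hK (dst m δ) {x | VReach step v (esrc x)} e P a5 a6] at r2
  exact r2

end Main

/-- every deterministic complete Muller automaton accepting `L(FB n)` has at
least `L(n)` states. -/
theorem muller_determinization_lower_bound (n : ℕ) (hn : 1 < n)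
    (T : Type) [Fintype T] (M : NMW (FBAlpha n) T)
    (hdet : ∃ q₀ : T, M.I = {q₀}) (hcomp : ∀ p a, ∃! q, M.Δ p a q)
    (hM : M.Lang = (FB n).Lang) :
    Lmax n ≤ Fintype.card T := by
  refine Finset.sup_le fun m hm => ?_
  exact Lnm_le_s12 m (by have := (Finset.mem_Ico.1 hm).1; omega) M hdet hcomp hM

end YanPaper
end

section
/- For every integer n > 1 and every integer k with 1 < k ≤ C(n−1, ⌊(n−1)/2⌋) (the binomial coefficient), and every finite set S' with |S'| = n−1, there exist k pairwise distinct subsets F_1, …, F_k of S', each of cardinality ⌊(n−1)/2⌋, such that every element q ∈ S' satisfies q ∉ F_i for at least ⌊k/2⌋ indices i ∈ {1, …, k}. -/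
namespace YanPaper

def fdeg {S : Type} [DecidableEq S] (𝒜 : Finset (Finset S)) (x : S) : ℤ :=
  ∑ A ∈ 𝒜, if x ∈ A then 1 else 0

lemma fdeg_eq {S : Type} [DecidableEq S] (𝒜 : Finset (Finset S)) (x : S) :
    fdeg 𝒜 x = ((𝒜.filter (fun A => x ∈ A)).card : ℤ) := by
  simp [fdeg]

lemma exch {S : Type} [DecidableEq S] (𝒜 : Finset (Finset S)) (p q : S)
    (h : fdeg 𝒜 q < fdeg 𝒜 p) :
    ∃ A ∈ 𝒜, p ∈ A ∧ q ∉ A ∧ A.map (Equiv.swap p q).toEmbedding ∉ 𝒜 := by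
  by_contra hc
  push Not at hc
  rw [fdeg_eq, fdeg_eq] at h
  have : (𝒜.filter (fun A => p ∈ A)).card ≤ (𝒜.filter (fun A => q ∈ A)).card := by
    apply Finset.card_le_card_of_injOn (fun A => A.map (Equiv.swap p q).toEmbedding)
    · intro A hA
      simp only [Finset.coe_filter, Set.mem_setOf_eq] at hA ⊢
      obtain ⟨hA, hp⟩ := hA
      refine ⟨?_, by simpa [Finset.mem_map_equiv] using hp⟩
      by_cases hq : q ∈ A
      · have : A.map (Equiv.swap p q).toEmbedding = A := by
          ext x
          rw [Finset.mem_map_equiv, Equiv.symm_swap]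
          by_cases h1 : x = p
          · subst h1; simp [hq, hp]
          by_cases h2 : x = q
          · subst h2; simp [hq, hp]
          rw [Equiv.swap_apply_of_ne_of_ne h1 h2]
        rwa [this]
      · exact hc A hA hp hq
    · intro A _ B _ hAB
      exact Finset.map_injective _ hAB
  omega

lemma exists_family {S : Type} [Fintype S] [DecidableEq S] (r k : ℕ)
    (hr : 2 * r ≤ Fintype.card S) (hk : k ≤ (Fintype.card S).choose r) :
    ∃ 𝒜 : Finset (Finset S), 𝒜.card = k ∧ (∀ A ∈ 𝒜, A.card = r) ∧
      ∀ x, 2 * fdeg 𝒜 x ≤ k + 1 := by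
  have hne : (Finset.powersetCard k (Finset.powersetCard r (Finset.univ : Finset S))).Nonempty := by
    rw [Finset.powersetCard_nonempty]
    simpa using hk
  obtain ⟨𝒜, h𝒜, hmin⟩ := Finset.exists_min_image _ (fun 𝒜 => ∑ x, (fdeg 𝒜 x)^2) hne
  rw [Finset.mem_powersetCard] at h𝒜
  obtain ⟨hsub, hcard⟩ := h𝒜
  have hsz : ∀ A ∈ 𝒜, A.card = r := fun A hA => by simpa using hsub hA
  refine ⟨𝒜, hcard, hsz, ?_⟩
  have hbal : ∀ p q, fdeg 𝒜 p ≤ fdeg 𝒜 q + 1 := by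
    intro p q
    by_contra hlt
    push Not at hlt
    obtain ⟨A, hA, hp, hq, hB⟩ := exch 𝒜 p q (by omega)
    set B := A.map (Equiv.swap p q).toEmbedding with hBdef
    have hpq : p ≠ q := by rintro rfl; exact hq hp
    have hBe : B ∉ 𝒜.erase A := fun h => hB (Finset.mem_of_mem_erase h)
    have hmem : insert B (𝒜.erase A) ∈
        Finset.powersetCard k (Finset.powersetCard r (Finset.univ : Finset S)) := by
      rw [Finset.mem_powersetCard]
      constructor
      · intro C hC
        rw [Finset.mem_insert] at hC
        rcases hC with rfl | hC
        · simp [hBdef, hsz A hA]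
        · exact hsub (Finset.mem_of_mem_erase hC)
      · rw [Finset.card_insert_of_notMem hBe, Finset.card_erase_add_one hA, hcard]
    have hm := hmin _ hmem
    have hd : ∀ x, (fdeg (insert B (𝒜.erase A)) x)^2 = (fdeg 𝒜 x)^2
        + (if x = p then 1 - 2 * fdeg 𝒜 x else 0) + (if x = q then 1 + 2 * fdeg 𝒜 x else 0) := by
      intro x
      have h1 : fdeg (insert B (𝒜.erase A)) x
          = (if x ∈ B then 1 else 0) + (fdeg 𝒜 x - if x ∈ A then 1 else 0) := by
        unfold fdeg
        rw [Finset.sum_insert hBe, Finset.sum_erase_eq_sub hA]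
      have h2 : x ∈ B ↔ Equiv.swap p q x ∈ A := by
        rw [hBdef, Finset.mem_map_equiv, Equiv.symm_swap]
      rw [h1]
      by_cases hxp : x = p
      · subst hxp
        simp [h2, hp, hq, hpq]; ring
      by_cases hxq : x = q
      · subst hxq
        simp [h2, hp, hq, hxp]; ring
      rw [Equiv.swap_apply_of_ne_of_ne hxp hxq] at h2
      simp [h2, hxp, hxq]
    simp only [hd, Finset.sum_add_distrib, Finset.sum_ite_eq', Finset.mem_univ, if_true] at hm
    omega
  have hsum : ∑ x, fdeg 𝒜 x = k * r := by
    unfold fdeg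
    rw [Finset.sum_comm, Finset.sum_congr rfl (g := fun _ => (r : ℤ))]
    · simp [hcard]
    · intro A hA
      simp [hsz A hA]
  intro p
  by_contra hlt
  push Not at hlt
  have : ∑ x : S, (k : ℤ) < ∑ x, 2 * fdeg 𝒜 x := by
    apply Finset.sum_lt_sum
    · intro x _
      have := hbal p x
      omega
    · exact ⟨p, Finset.mem_univ _, by omega⟩
  rw [← Finset.mul_sum, hsum] at this
  simp at this
  have h3 : (2 * r : ℤ) ≤ Fintype.card S := by exact_mod_cast hr
  nlinarith [Int.natCast_nonneg k]

/-- existence of a minimal acceptance condition: `k` pairwise distinct subsets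
of `S'`, each of size `⌊(n-1)/2⌋`, such that every element avoids at least `⌊k/2⌋` of them. -/
theorem exists_good_acceptance_condition (n k : ℕ) (hn : 1 < n) (hk1 : 1 < k)
    (hk2 : k ≤ (n - 1).choose ((n - 1) / 2))
    (S' : Type) [Fintype S'] (hS' : Fintype.card S' = n - 1) :
    ∃ F : Fin k → Finset S', Function.Injective F ∧
      (∀ i, (F i).card = (n - 1) / 2) ∧
      ∀ q : S', k / 2 ≤ {i : Fin k | q ∉ F i}.ncard := by
  classical
  obtain ⟨𝒜, hc, hsz, hd⟩ := exists_family (S := S') ((n-1)/2) k (by omega) (by rwa [hS'])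
  let e := 𝒜.equivFinOfCardEq hc
  have hinj : Function.Injective (fun i => ((e.symm i : 𝒜) : Finset S')) :=
    Subtype.val_injective.comp e.symm.injective
  refine ⟨fun i => (e.symm i : 𝒜), hinj, fun i => hsz _ (e.symm i).2, fun q => ?_⟩
  rw [← Set.ncard_image_of_injective _ hinj]
  have him : (fun i => ((e.symm i : 𝒜) : Finset S')) '' {i | q ∉ ((e.symm i : 𝒜) : Finset S')}
      = ((𝒜.filter (fun A => ¬ q ∈ A) : Finset (Finset S')) : Set (Finset S')) := by
    ext A
    simp only [Set.mem_image, Set.mem_setOf_eq, Finset.coe_filter]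
    constructor
    · rintro ⟨i, hi, rfl⟩
      exact ⟨(e.symm i).2, hi⟩
    · rintro ⟨hA, hq⟩
      exact ⟨e ⟨A, hA⟩, by simpa using hq, by simp⟩
  rw [him, Set.ncard_coe_finset]
  have h1 := Finset.card_filter_add_card_filter_not (s := 𝒜) (fun A => q ∈ A)
  have h2 := hd q
  rw [fdeg_eq] at h2
  omega

end YanPaper
end

section
/- Let B be an NGBW over an alphabet Σ and let W be a finite conflict set for B. Then every NGBW accepting the complement Σ^ω \ L(B) has at least |W| states. -/
namespace YanPaper

theorem listPow_length {A : Type*} (w : List A) (k : ℕ) :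
    (listPow w k).length = k * w.length := by
  simp [listPow]

theorem listPow_getElem? {A : Type*} (w : List A) (k i : ℕ) (h : i < k * w.length) :
    (listPow w k)[i]? = w[i % w.length]? := by
  induction k generalizing i with
  | zero => simp at h
  | succ k ih =>
    have e : listPow w (k + 1) = w ++ listPow w k := by
      simp [listPow, List.replicate_succ]
    rw [e]
    by_cases hi : i < w.length
    · rw [List.getElem?_append_left hi, Nat.mod_eq_of_lt hi]
    · rw [List.getElem?_append_right (by omega), ih, ← Nat.mod_eq_sub_mod (by omega)]
      rw [Nat.succ_mul] at h
      omega

theorem conflict_set_aux {A T : Type*} (C : NGBW A T) (α₁ α₂ : ℕ → A) (ρ₁ ρ₂ : ℕ → T)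
    (a b c d : ℕ) (hb : 0 < b) (hc : 0 < c) (hI : ρ₁ 0 ∈ C.I)
    (h₁ : ∀ i, C.Δ (ρ₁ i) (α₁ i) (ρ₁ (i + 1)))
    (h₂ : ∀ i, C.Δ (ρ₂ i) (α₂ i) (ρ₂ (i + 1)))
    (e₁ : ρ₁ (a + b) = ρ₁ a) (e₂ : ρ₂ d = ρ₁ a) (e₃ : ρ₂ (d + c) = ρ₁ a)
    (hF : ∀ i, ∃ j, j < b ∧ ρ₁ (a + j) ∈ C.F i) :
    (fun n => if n < a then α₁ n else
      if (n - a) % (b + c) < b then α₁ (a + (n - a) % (b + c))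
      else α₂ (d + ((n - a) % (b + c) - b))) ∈ C.Lang := by
  refine ⟨fun n => if n < a then ρ₁ n else
      if (n - a) % (b + c) < b then ρ₁ (a + (n - a) % (b + c))
      else ρ₂ (d + ((n - a) % (b + c) - b)), ?_, ?_, ?_⟩
  · by_cases h : 0 < a
    · simpa [h] using hI
    · have : a = 0 := by omega
      subst this
      simpa [hb] using hI
  · intro n
    by_cases hn : n < a
    · by_cases hn' : n + 1 < a
      · simpa [hn, hn'] using h₁ n
      · have : a = n + 1 := by omega
        subst this
        simpa [hb] using h₁ n
    · have hn' : ¬ n + 1 < a := by omega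
      have hs : n + 1 - a = (n - a) + 1 := by omega
      simp only [hn, hn', if_false, hs]
      generalize n - a = m
      have hlt := Nat.mod_lt m (show 0 < b + c by omega)
      have hm : (m + 1) % (b + c) =
          if m % (b + c) + 1 = b + c then 0 else m % (b + c) + 1 := by
        rw [← Nat.mod_add_mod]
        split_ifs with h
        · rw [h, Nat.mod_self]
        · exact Nat.mod_eq_of_lt (by omega)
      rw [hm]
      generalize m % (b + c) = j at hlt
      by_cases hj : j < b
      · rw [if_neg (show ¬ j + 1 = b + c by omega)]
        simp only [hj, if_true]
        by_cases hj' : j + 1 < b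
        · simpa [hj', Nat.add_assoc] using h₁ (a + j)
        · have : b = j + 1 := by omega
          subst this
          have := h₁ (a + j)
          rw [Nat.add_assoc, e₁, ← e₂] at this
          simpa using this
      · simp only [hj, if_false]
        have := h₂ (d + (j - b))
        by_cases hj' : j + 1 = b + c
        · have e : d + (j - b) + 1 = d + c := by omega
          rw [e, e₃] at this
          simpa [hj', hb] using this
        · have hj2 : ¬ j + 1 < b := by omega
          have e : d + (j - b) + 1 = d + (j + 1 - b) := by omega
          rw [e] at this
          simpa only [hj', hj2, if_false] using this
  · intro i
    obtain ⟨j, hj, hji⟩ := hF i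
    refine ⟨ρ₁ (a + j), fun N => ⟨a + (N * (b + c) + j), ?_, ?_⟩, hji⟩
    · have : N ≤ N * (b + c) := Nat.le_mul_of_pos_right _ (by omega)
      omega
    · have : (N * (b + c) + j) % (b + c) = j := by
        rw [Nat.mul_add_mod', Nat.mod_eq_of_lt (by omega)]
      simp [this, hj]

/-- if `W` is a finite conflict set for the NGBW `B`, then every NGBW
accepting the complement of `L(B)` has at least `|W|` states. -/
theorem conflict_set_ngbw_lower_bound (A S : Type) [Fintype S] (B : NGBW A S)
    (W : Finset (List A)) (hseg : ∀ w ∈ W, GCSeg B w)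
    (hconf : ∀ w₁ ∈ W, ∀ w₂ ∈ W, w₁ ≠ w₂ → Conflict B w₁ w₂)
    (T : Type) [Fintype T] (C : NGBW A T) (hC : C.Lang = B.Langᶜ) :
    W.card ≤ Fintype.card T := by
  classical
  have key : ∀ w : List A, w ∈ W → ∃ (t : T) (ρ : ℕ → T) (α : ℕ → A),
      (∀ n, w[n % w.length]? = some (α n)) ∧ 0 < w.length ∧ ρ 0 ∈ C.I ∧
      (∀ i, C.Δ (ρ i) (α i) (ρ (i + 1))) ∧ (∀ i, (InfOcc ρ ∩ C.F i).Nonempty) ∧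
      ∀ N, ∃ m, N < m ∧ ρ (m * w.length) = t := by
    intro w hw
    obtain ⟨hne, hrej⟩ := hseg w hw
    have hpos : 0 < w.length := List.length_pos_iff.mpr hne
    let α : ℕ → A := fun n => w[n % w.length]'(Nat.mod_lt _ hpos)
    have hα : ∀ n, w[n % w.length]? = some (α n) := fun n =>
      List.getElem?_eq_getElem (Nat.mod_lt _ hpos)
    have hin : α ∈ C.Lang := by
      rw [hC]
      apply hrej
      refine ⟨fun i h => by simp at h, fun i j h => ?_⟩
      have := hα (i * w.length + j)
      rw [Nat.mul_add_mod', Nat.mod_eq_of_lt h, List.getElem?_eq_getElem h] at this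
      simpa using (Option.some.inj this).symm
    obtain ⟨ρ, h0, h1, h2⟩ := hin
    obtain ⟨t, ht⟩ := Finite.exists_infinite_fiber (fun m => ρ (m * w.length))
    refine ⟨t, ρ, α, hα, hpos, h0, h1, h2, fun N => ?_⟩
    obtain ⟨m, hm, hN⟩ := (Set.infinite_coe_iff.mp ht).exists_gt N
    exact ⟨m, hN, hm⟩
  rcases W.eq_empty_or_nonempty with rfl | ⟨v, hv⟩
  · simp
  have : Nonempty T := ⟨(key v hv).choose⟩
  have key' : ∀ w : List A, ∃ t : T, w ∈ W → ∃ (ρ : ℕ → T) (α : ℕ → A),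
      (∀ n, w[n % w.length]? = some (α n)) ∧ 0 < w.length ∧ ρ 0 ∈ C.I ∧
      (∀ i, C.Δ (ρ i) (α i) (ρ (i + 1))) ∧ (∀ i, (InfOcc ρ ∩ C.F i).Nonempty) ∧
      ∀ N, ∃ m, N < m ∧ ρ (m * w.length) = t := by
    intro w
    by_cases hw : w ∈ W
    · obtain ⟨t, ht⟩ := key w hw
      exact ⟨t, fun _ => ht⟩
    · exact ⟨Classical.arbitrary T, fun h => absurd h hw⟩
  choose f hf using key'
  rw [← Finset.card_univ]
  refine Finset.card_le_card_of_injOn f (fun _ _ => Finset.mem_univ _) ?_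
  intro w₁ hw₁ w₂ hw₂ heq
  by_contra hne
  obtain ⟨ρ₁, α₁, hα₁, hp₁, hI₁, hΔ₁, hF₁, hr₁⟩ := hf w₁ hw₁
  obtain ⟨ρ₂, α₂, hα₂, hp₂, -, hΔ₂, -, hr₂⟩ := hf w₂ hw₂
  rw [← heq] at hr₂
  generalize f w₁ = t at hr₁ hr₂
  obtain ⟨k₀, hk₀, ht₀⟩ := hr₁ 0
  have hm : ∀ i, ∃ m, k₀ * w₁.length ≤ m ∧ ρ₁ m ∈ C.F i := by
    intro i
    obtain ⟨s, hs, hsF⟩ := hF₁ i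
    obtain ⟨m, hm, rfl⟩ := hs (k₀ * w₁.length)
    exact ⟨m, hm, hsF⟩
  choose m hm hmF using hm
  obtain ⟨K, hK, htK⟩ := hr₁ (k₀ + Finset.univ.sup m)
  obtain ⟨l₀, hl₀, hs₀⟩ := hr₂ 0
  obtain ⟨l₁, hl₁, hs₁⟩ := hr₂ l₀
  obtain ⟨k₁, rfl⟩ := Nat.exists_eq_add_of_lt (show k₀ < K by omega)
  obtain ⟨k₂, rfl⟩ := Nat.exists_eq_add_of_lt hl₁
  have hb : 0 < (k₁ + 1) * w₁.length := by positivity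
  have hc : 0 < (k₂ + 1) * w₂.length := by positivity
  have hmem := conflict_set_aux C α₁ α₂ ρ₁ ρ₂ (k₀ * w₁.length) ((k₁ + 1) * w₁.length)
    ((k₂ + 1) * w₂.length) (l₀ * w₂.length) hb hc hI₁ hΔ₁ hΔ₂
    (by rw [← Nat.add_mul, ht₀, ← htK]; rfl) (by rw [hs₀, ht₀])
    (by rw [← Nat.add_mul, ht₀, ← hs₁]; rfl) (by
      intro i
      refine ⟨m i - k₀ * w₁.length, ?_, ?_⟩
      · have h1 : m i ≤ Finset.univ.sup m := Finset.le_sup (Finset.mem_univ i)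
        have h2 := hm i
        have h3 : (k₀ + k₁ + 1) ≤ (k₀ + k₁ + 1) * w₁.length :=
          Nat.le_mul_of_pos_right _ hp₁
        have h4 : (k₀ + k₁ + 1) * w₁.length = k₀ * w₁.length + (k₁ + 1) * w₁.length := by
          ring
        omega
      · rw [Nat.add_sub_cancel' (hm i)]
        exact hmF i)
  rw [hC] at hmem
  refine hmem (hconf w₁ hw₁ w₂ hw₂ hne k₀ (k₁ + 1) (k₂ + 1) hk₀ (by omega) (by omega) _ ?_)
  constructor
  · intro i h
    have h' := h
    rw [listPow_length] at h'
    simp only [h', if_true]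
    apply Option.some.inj
    rw [← hα₁, List.get_eq_getElem, ← List.getElem?_eq_getElem, listPow_getElem? _ _ _ h']
  · intro i j h
    have h' := h
    rw [List.length_append, listPow_length, listPow_length] at h'
    apply Option.some.inj
    rw [List.get_eq_getElem, ← List.getElem?_eq_getElem]
    dsimp only
    rw [List.length_append, listPow_length, listPow_length, listPow_length]
    have e : (k₀ * w₁.length + i * ((k₁ + 1) * w₁.length + (k₂ + 1) * w₂.length) + j
        - k₀ * w₁.length) % ((k₁ + 1) * w₁.length + (k₂ + 1) * w₂.length) = j := by
      rw [Nat.add_assoc, Nat.add_sub_cancel_left, Nat.mul_add_mod', Nat.mod_eq_of_lt h']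
    have hn : ¬ (k₀ * w₁.length + i * ((k₁ + 1) * w₁.length + (k₂ + 1) * w₂.length) + j
        < k₀ * w₁.length) := by omega
    simp only [e, hn, if_false]
    by_cases hj : j < (k₁ + 1) * w₁.length
    · rw [if_pos hj, ← hα₁, List.getElem?_append_left (by rwa [listPow_length]),
        listPow_getElem? _ _ _ hj, Nat.mul_add_mod']
    · rw [if_neg hj, ← hα₂, List.getElem?_append_right (by rw [listPow_length]; omega),
        listPow_length, listPow_getElem? _ _ _ (by omega), Nat.mul_add_mod']

end YanPaper
end
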